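/- arXiv:1609.05005 — 3 statements merged into one kernel-verified Lean document; each statement's English description precedes it below -/
import Mathlib

section
/- Let R = ℂ[x,y] and let I ⊆ R be an ideal with dim_ℂ(R/I) = n. Then the ℂ-vector space Hom_R(I, R/I) of R-module homomorphisms from I to R/I has dimension 2n. (This is the statement that the Zariski tangent space of the Hilbert scheme Hilb^n(ℂ²) has dimension 2n at every point, i.e. that Hilb^n(ℂ²) is smooth.) -/
/-!
Statement 6: for any ideal I of R = ℂ[x,y] with dim_ℂ(R/I) = n, the ℂ-vector space
Hom_R(I, R/I) has dimension 2n (smoothness of Hilb^n(ℂ²)).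
-/

set_option synthInstance.maxHeartbeats 1000000
set_option maxHeartbeats 1000000

noncomputable section

/-- `R = ℂ[x,y]`. -/
abbrev Rxy : Type := MvPolynomial (Fin 2) ℂ

section LinAlg
variable {V : Type*} [AddCommGroup V] [Module ℂ V]

/-- commutators with `Y`, `X`. -/
def dz (X Y : V →ₗ[ℂ] V) : (V →ₗ[ℂ] V) →ₗ[ℂ] (V →ₗ[ℂ] V) × (V →ₗ[ℂ] V) where
  toFun c := (c * X - X * c, c * Y - Y * c)
  map_add' a b := by ext <;> simp <;> abel
  map_smul' a b := by ext <;> simp [smul_sub]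

/-- second Koszul differential. -/
def dd (X Y : V →ₗ[ℂ] V) : (V →ₗ[ℂ] V) × (V →ₗ[ℂ] V) →ₗ[ℂ] (V →ₗ[ℂ] V) where
  toFun p := (X * p.2 - p.2 * X) - (Y * p.1 - p.1 * Y)
  map_add' a b := by ext; simp; abel
  map_smul' a b := by ext; simp [smul_sub]

/-- trace pairing -/
def tau : (V →ₗ[ℂ] V) →ₗ[ℂ] Module.Dual ℂ (V →ₗ[ℂ] V) where
  toFun c := (LinearMap.trace ℂ V) ∘ₗ (LinearMap.mulLeft ℂ c)
  map_add' a b := by ext; simp [add_mul]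
  map_smul' a b := by ext; simp

lemma tau_apply (c d : V →ₗ[ℂ] V) : tau c d = LinearMap.trace ℂ V (c * d) := rfl

lemma tau_inj [FiniteDimensional ℂ V] : Function.Injective (tau : (V →ₗ[ℂ] V) →ₗ[ℂ] _) := by
  rw [injective_iff_map_eq_zero]
  intro c hc
  ext v
  rw [LinearMap.zero_apply, ← Module.forall_dual_apply_eq_zero_iff ℂ]
  intro l
  have := LinearMap.congr_fun hc (l.smulRight v)
  rw [tau_apply] at this
  have h2 : c * l.smulRight v = l.smulRight (c v) := by ext; simp
  rw [h2, LinearMap.trace_smulRight] at this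
  simpa using this

lemma finrank_ker_dd [FiniteDimensional ℂ V] (X Y : V →ₗ[ℂ] V) :
    Module.finrank ℂ (LinearMap.ker (dd X Y)) =
      Module.finrank ℂ (V →ₗ[ℂ] V) + Module.finrank ℂ (LinearMap.ker (dz X Y)) := by
  have h1 := LinearMap.finrank_range_add_finrank_ker (dd X Y)
  have h2 := LinearMap.finrank_range_add_finrank_ker (dd X Y).dualMap
  rw [LinearMap.finrank_range_dualMap_eq_finrank_range, Subspace.dual_finrank_eq] at h2
  rw [Module.finrank_prod] at h1
  let e : (V →ₗ[ℂ] V) ≃ₗ[ℂ] Module.Dual ℂ (V →ₗ[ℂ] V) :=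
    LinearEquiv.ofInjectiveOfFinrankEq tau tau_inj (Subspace.dual_finrank_eq).symm
  have he : ∀ c, e c = tau c := fun c => rfl
  have h3 : (LinearMap.ker (dd X Y).dualMap).comap (e : _ →ₗ[ℂ] _) = LinearMap.ker (dz X Y) := by
    ext c
    simp only [Submodule.mem_comap, LinearMap.mem_ker, LinearEquiv.coe_coe, he]
    have key : ∀ a b, tau c (dd X Y (a, b)) = tau (c * X - X * c) b - tau (c * Y - Y * c) a := by
      intro a b
      simp only [tau_apply, dd, LinearMap.coe_mk, AddHom.coe_mk, map_sub, LinearMap.sub_apply]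
      rw [← mul_assoc c b X, LinearMap.trace_mul_comm ℂ (c * b) X,
        ← mul_assoc c a Y, LinearMap.trace_mul_comm ℂ (c * a) Y]
      simp only [Module.End.mul_eq_comp, LinearMap.comp_assoc]
    constructor
    · intro h
      have h' : ∀ a b, tau c (dd X Y (a, b)) = 0 := fun a b => LinearMap.congr_fun h (a, b)
      refine Prod.ext ?_ ?_
      · apply tau_inj
        rw [Prod.fst_zero, map_zero]
        refine LinearMap.ext fun b => ?_
        have := h' 0 b
        rw [key, map_zero, sub_zero] at this
        exact this
      · apply tau_inj
        rw [Prod.snd_zero, map_zero]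
        refine LinearMap.ext fun b => ?_
        have := h' b 0
        rw [key, map_zero, zero_sub, neg_eq_zero] at this
        exact this
    · intro h
      have ha : c * X - X * c = 0 := congrArg Prod.fst h
      have hb : c * Y - Y * c = 0 := congrArg Prod.snd h
      refine LinearMap.ext fun p => ?_
      have := key p.1 p.2
      rw [ha, hb] at this
      simpa using this
  have h4 : Module.finrank ℂ (LinearMap.ker (dd X Y).dualMap) =
      Module.finrank ℂ (LinearMap.ker (dz X Y)) := by
    rw [← h3]
    rw [← LinearEquiv.finrank_map_eq e, Submodule.map_comap_eq_of_surjective e.surjective]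
  omega

end LinAlg

section Main
variable {M : Type} [AddCommGroup M] [Module ℂ M] [Module Rxy M] [IsScalarTower ℂ Rxy M]

/-- multiplication by a polynomial -/
def mu (f : Rxy) : M →ₗ[ℂ] M := Algebra.lsmul ℂ ℂ M f

lemma mu_apply (f : Rxy) (m : M) : mu f m = f • m := rfl

lemma lin_of_comm {A B : Type*} [AddCommGroup A] [Module ℂ A] [Module Rxy A] [IsScalarTower ℂ Rxy A]
    [AddCommGroup B] [Module ℂ B] [Module Rxy B] [IsScalarTower ℂ Rxy B]
    (c : A →ₗ[ℂ] B) (h : ∀ i m, c ((MvPolynomial.X i : Rxy) • m) = (MvPolynomial.X i : Rxy) • c m)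
    (f : Rxy) (m : A) : c (f • m) = f • c m := by
  induction f using MvPolynomial.induction_on generalizing m with
  | C a =>
    have h1 : ∀ m : A, (MvPolynomial.C a : Rxy) • m = a • m := fun m => by
      rw [← mul_one (MvPolynomial.C a), ← MvPolynomial.smul_eq_C_mul, smul_assoc, one_smul]
    have h2 : ∀ m : B, (MvPolynomial.C a : Rxy) • m = a • m := fun m => by
      rw [← mul_one (MvPolynomial.C a), ← MvPolynomial.smul_eq_C_mul, smul_assoc, one_smul]
    rw [h1, h2, map_smul]
  | add p q hp hq => rw [add_smul, map_add, hp, hq, add_smul]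
  | mul_X p i hp => rw [mul_smul, hp, h, mul_smul]

lemma ker_dz (π : Rxy →ₗ[Rxy] M) (hπ : Function.Surjective π) [FiniteDimensional ℂ M] :
    Module.finrank ℂ (LinearMap.ker (dz (mu (M := M) (MvPolynomial.X 0)) (mu (MvPolynomial.X 1))))
      = Module.finrank ℂ M := by
  refine LinearEquiv.finrank_eq (LinearEquiv.ofBijective
    ((LinearMap.applyₗ (π 1)) ∘ₗ (Submodule.subtype _)) ⟨?_, ?_⟩)
  · rw [injective_iff_map_eq_zero]
    rintro ⟨c, hc⟩ h
    have h0 : c (π 1) = 0 := h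
    have h1 : c * mu (MvPolynomial.X 0) - mu (MvPolynomial.X 0) * c = 0 := congrArg Prod.fst hc
    have h2 : c * mu (MvPolynomial.X 1) - mu (MvPolynomial.X 1) * c = 0 := congrArg Prod.snd hc
    have h3 := lin_of_comm c (by
      intro i m
      fin_cases i
      · exact LinearMap.congr_fun (sub_eq_zero.1 h1) m
      · exact LinearMap.congr_fun (sub_eq_zero.1 h2) m)
    apply Subtype.ext
    refine LinearMap.ext fun m => ?_
    obtain ⟨f, rfl⟩ := hπ m
    have : π f = f • π 1 := by rw [← map_smul, smul_eq_mul, mul_one]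
    change c (π f) = 0
    rw [this, h3, h0, smul_zero]
  · intro m
    obtain ⟨g, rfl⟩ := hπ m
    refine ⟨⟨mu g, ?_⟩, ?_⟩
    · refine Prod.ext ?_ ?_
      · refine sub_eq_zero.2 (LinearMap.ext fun m => ?_)
        exact smul_comm g (MvPolynomial.X 0 : Rxy) m
      · refine sub_eq_zero.2 (LinearMap.ext fun m => ?_)
        exact smul_comm g (MvPolynomial.X 1 : Rxy) m
    · change g • π 1 = π g
      rw [← map_smul, smul_eq_mul, mul_one]


/-- The extended space of compatible tuples `(ψ, φ, (a, b))`. -/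
def WW (I : Ideal Rxy) (π : Rxy →ₗ[Rxy] M) :
    Submodule ℂ ((Rxy →ₗ[ℂ] M) × (I →ₗ[Rxy] M) × ((M →ₗ[ℂ] M) × (M →ₗ[ℂ] M))) where
  carrier := {p | (∀ f : I, p.1 f = p.2.1 f) ∧
    (∀ f : Rxy, p.1 (MvPolynomial.X 0 * f) = p.2.2.1 (π f) + (MvPolynomial.X 0 : Rxy) • p.1 f) ∧
    (∀ f : Rxy, p.1 (MvPolynomial.X 1 * f) = p.2.2.2 (π f) + (MvPolynomial.X 1 : Rxy) • p.1 f)}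
  zero_mem' := by simp
  add_mem' := by
    rintro p q ⟨h1, h2, h3⟩ ⟨k1, k2, k3⟩
    refine ⟨fun f => ?_, fun f => ?_, fun f => ?_⟩
    · simp [h1, k1]
    · simp only [Prod.fst_add, Prod.snd_add, LinearMap.add_apply, h2, k2, smul_add]; abel
    · simp only [Prod.fst_add, Prod.snd_add, LinearMap.add_apply, h3, k3, smul_add]; abel
  smul_mem' := by
    rintro c p ⟨h1, h2, h3⟩
    refine ⟨fun f => ?_, fun f => ?_, fun f => ?_⟩
    · simp [h1]
    · simp only [Prod.smul_fst, Prod.smul_snd, LinearMap.smul_apply, h2, smul_add,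
        smul_comm c (MvPolynomial.X 0 : Rxy)]
    · simp only [Prod.smul_fst, Prod.smul_snd, LinearMap.smul_apply, h3, smul_add,
        smul_comm c (MvPolynomial.X 1 : Rxy)]

/-- projection to `Hom_R(I, M)` -/
def pH (I : Ideal Rxy) (π : Rxy →ₗ[Rxy] M) : WW I π →ₗ[ℂ] (I →ₗ[Rxy] M) :=
  (LinearMap.fst ℂ _ _ ∘ₗ LinearMap.snd ℂ _ _) ∘ₗ (WW I π).subtype

/-- projection to pairs -/
def pE (I : Ideal Rxy) (π : Rxy →ₗ[Rxy] M) : WW I π →ₗ[ℂ] ((M →ₗ[ℂ] M) × (M →ₗ[ℂ] M)) :=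
  (LinearMap.snd ℂ _ _ ∘ₗ LinearMap.snd ℂ _ _) ∘ₗ (WW I π).subtype

lemma pi_smul (π : Rxy →ₗ[Rxy] M) (f g : Rxy) : π (f * g) = f • π g := map_smul π f g

lemma smul_lin (ψ : Rxy →ₗ[ℂ] M)
    (h0 : ∀ f : Rxy, ψ (MvPolynomial.X 0 * f) = (MvPolynomial.X 0 : Rxy) • ψ f)
    (h1 : ∀ f : Rxy, ψ (MvPolynomial.X 1 * f) = (MvPolynomial.X 1 : Rxy) • ψ f) (f : Rxy) :
    ψ f = f • ψ 1 := by
  have := lin_of_comm ψ (by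
      intro i m
      fin_cases i
      · exact h0 m
      · exact h1 m) f 1
  rwa [smul_eq_mul, mul_one] at this

lemma rank_ker_pE (I : Ideal Rxy) (π : Rxy →ₗ[Rxy] M) :
    Module.rank ℂ (LinearMap.ker (pE I π)) = Module.rank ℂ M := by
  refine LinearEquiv.rank_eq (LinearEquiv.ofBijective
    ((LinearMap.applyₗ (1 : Rxy)) ∘ₗ (LinearMap.fst ℂ _ _) ∘ₗ (WW I π).subtype ∘ₗ
      (Submodule.subtype _)) ⟨?_, ?_⟩)
  · rw [injective_iff_map_eq_zero]
    rintro ⟨⟨⟨ψ, φ, a, b⟩, h1, h2, h3⟩, hk⟩ h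
    have h0 : ψ 1 = 0 := h
    have ha : a = 0 := congrArg Prod.fst hk
    have hb : b = 0 := congrArg Prod.snd hk
    subst ha hb
    have hψ : ψ = 0 := by
      refine LinearMap.ext fun f => ?_
      rw [smul_lin ψ (by simpa using h2) (by simpa using h3) f, h0]; simp
    subst hψ
    have hφ : φ = 0 := by
      refine LinearMap.ext fun f => ?_
      exact (h1 f).symm
    subst hφ
    rfl
  · intro m
    refine ⟨⟨⟨⟨(LinearMap.toSpanSingleton Rxy M m).restrictScalars ℂ,
      (LinearMap.toSpanSingleton Rxy M m) ∘ₗ I.subtype, 0, 0⟩, ?_, ?_, ?_⟩, ?_⟩, ?_⟩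
    · intro f; rfl
    · intro f; simp [mul_smul]
    · intro f; simp [mul_smul]
    · rfl
    · change (1 : Rxy) • m = m
      simp

lemma rank_ker_pH (I : Ideal Rxy) (π : Rxy →ₗ[Rxy] M) (hπ : Function.Surjective π)
    (hI : ∀ f, π f = 0 ↔ f ∈ I) :
    Module.rank ℂ (LinearMap.ker (pH I π)) = Module.rank ℂ (M →ₗ[ℂ] M) := by
  symm
  let X : M →ₗ[ℂ] M := mu (MvPolynomial.X 0)
  let Y : M →ₗ[ℂ] M := mu (MvPolynomial.X 1)
  let j : (M →ₗ[ℂ] M) →ₗ[ℂ] LinearMap.ker (pH I π) :=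
    { toFun := fun u => ⟨⟨⟨u ∘ₗ π.restrictScalars ℂ, 0, dz X Y u⟩, by
        refine ⟨fun f => ?_, fun f => ?_, fun f => ?_⟩
        · simp [(hI f).2 f.2]
        · simp [dz, X, mu_apply, pi_smul]
        · simp [dz, Y, mu_apply, pi_smul]⟩, rfl⟩
      map_add' := fun u v => by
        apply Subtype.ext; apply Subtype.ext
        simp [LinearMap.add_comp]
      map_smul' := fun u v => by
        apply Subtype.ext; apply Subtype.ext
        simp [LinearMap.smul_comp] }
  refine LinearEquiv.rank_eq (LinearEquiv.ofBijective j ⟨?_, ?_⟩)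
  · intro u v h
    have h1 : u ∘ₗ π.restrictScalars ℂ = v ∘ₗ π.restrictScalars ℂ :=
      congrArg (fun z => z.1.1.1) h
    refine LinearMap.ext fun m => ?_
    obtain ⟨f, rfl⟩ := hπ m
    exact LinearMap.congr_fun h1 f
  · rintro ⟨⟨⟨ψ, φ, a, b⟩, h1, h2, h3⟩, hk⟩
    have hφ : φ = 0 := hk
    subst hφ
    have hker : LinearMap.ker (π.restrictScalars ℂ) ≤ LinearMap.ker ψ := by
      intro f hf
      exact h1 ⟨f, (hI f).1 hf⟩
    obtain ⟨s, hs⟩ := (π.restrictScalars ℂ).exists_rightInverse_of_surjective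
      (LinearMap.range_eq_top.2 hπ)
    have hs' : ∀ m, π (s m) = m := fun m => LinearMap.congr_fun hs m
    have hu : ∀ f, ψ (s (π f)) = ψ f := by
      intro f
      rw [← sub_eq_zero, ← map_sub]
      apply hker
      change π _ = 0
      rw [map_sub, hs', sub_self]
    refine ⟨ψ ∘ₗ s, ?_⟩
    apply Subtype.ext; apply Subtype.ext
    refine Prod.ext ?_ (Prod.ext rfl (Prod.ext ?_ ?_))
    · exact LinearMap.ext hu
    · refine LinearMap.ext fun m => ?_
      obtain ⟨f, rfl⟩ := hπ m
      change ψ (s ((MvPolynomial.X 0 : Rxy) • π f)) - (MvPolynomial.X 0 : Rxy) • ψ (s (π f))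
        = a (π f)
      rw [← pi_smul, hu, hu, sub_eq_iff_eq_add]
      exact h2 f
    · refine LinearMap.ext fun m => ?_
      obtain ⟨f, rfl⟩ := hπ m
      change ψ (s ((MvPolynomial.X 1 : Rxy) • π f)) - (MvPolynomial.X 1 : Rxy) • ψ (s (π f))
        = b (π f)
      rw [← pi_smul, hu, hu, sub_eq_iff_eq_add]
      exact h3 f

lemma pH_surj (I : Ideal Rxy) (π : Rxy →ₗ[Rxy] M) (hπ : Function.Surjective π)
    (hI : ∀ f, π f = 0 ↔ f ∈ I) : Function.Surjective (pH I π) := by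
  intro φ
  obtain ⟨ψ, hψ⟩ := LinearMap.exists_extend (p := I.restrictScalars ℂ) (φ.restrictScalars ℂ)
  have h1 : ∀ f : I, ψ f = φ f := fun f => LinearMap.congr_fun hψ f
  obtain ⟨s, hs⟩ := (π.restrictScalars ℂ).exists_rightInverse_of_surjective
      (LinearMap.range_eq_top.2 hπ)
  have hs' : ∀ m, π (s m) = m := fun m => LinearMap.congr_fun hs m
  have key : ∀ g f : Rxy, ψ (g * f) = (ψ (g * s (π f)) - g • ψ (s (π f))) + g • ψ f := by
    intro g f
    have hm : f - s (π f) ∈ I := by rw [← hI, map_sub, hs', sub_self]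
    have e1 : ψ (f - s (π f)) = φ ⟨_, hm⟩ := h1 ⟨_, hm⟩
    have e2 : ψ (g * (f - s (π f))) = g • φ ⟨_, hm⟩ := by
      rw [← φ.map_smul]
      exact h1 ⟨g * (f - s (π f)), I.mul_mem_left g hm⟩
    rw [← e1, mul_sub, map_sub, map_sub, smul_sub] at e2
    rw [sub_eq_iff_eq_add] at e2
    rw [e2]; abel
  let a : Rxy → (M →ₗ[ℂ] M) := fun g => ψ ∘ₗ LinearMap.mulLeft ℂ g ∘ₗ s - mu g ∘ₗ ψ ∘ₗ s
  exact ⟨⟨⟨ψ, φ, a (MvPolynomial.X 0), a (MvPolynomial.X 1)⟩, h1, key _, key _⟩, rfl⟩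

lemma range_pE (I : Ideal Rxy) (π : Rxy →ₗ[Rxy] M) (hπ : Function.Surjective π)
    (hI : ∀ f, π f = 0 ↔ f ∈ I) : LinearMap.range (pE I π) =
      LinearMap.ker (dd (mu (M := M) (MvPolynomial.X 0)) (mu (MvPolynomial.X 1))) := by
  apply le_antisymm
  · rintro _ ⟨⟨⟨ψ, φ, a, b⟩, h1, h2, h3⟩, rfl⟩
    rw [LinearMap.mem_ker]
    refine LinearMap.ext fun m => ?_
    obtain ⟨f, rfl⟩ := hπ m
    change ((MvPolynomial.X 0 : Rxy) • b (π f) - b ((MvPolynomial.X 0 : Rxy) • π f)) -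
      ((MvPolynomial.X 1 : Rxy) • a (π f) - a ((MvPolynomial.X 1 : Rxy) • π f)) = 0
    dsimp only at h2 h3
    have e := h2 (MvPolynomial.X 1 * f)
    rw [mul_left_comm, h3, h2, h3, pi_smul, pi_smul, smul_add, smul_add,
      smul_comm (MvPolynomial.X 1 : Rxy) (MvPolynomial.X 0 : Rxy)] at e
    rw [← add_assoc, ← add_assoc, add_left_inj] at e
    rw [sub_sub_sub_comm, sub_eq_zero, ← sub_eq_zero]
    rw [← sub_eq_zero] at e
    rw [← neg_eq_zero, ← e]
    abel
  · rintro ⟨a, b⟩ hab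
    let E0 : M × M →ₗ[ℂ] M × M := LinearMap.prod (mu (MvPolynomial.X 0) ∘ₗ LinearMap.fst ℂ M M)
      (a ∘ₗ LinearMap.fst ℂ M M + mu (MvPolynomial.X 0) ∘ₗ LinearMap.snd ℂ M M)
    let E1 : M × M →ₗ[ℂ] M × M := LinearMap.prod (mu (MvPolynomial.X 1) ∘ₗ LinearMap.fst ℂ M M)
      (b ∘ₗ LinearMap.fst ℂ M M + mu (MvPolynomial.X 1) ∘ₗ LinearMap.snd ℂ M M)
    have hab' : ∀ m, ((MvPolynomial.X 0 : Rxy) • b m - b ((MvPolynomial.X 0 : Rxy) • m)) -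
      ((MvPolynomial.X 1 : Rxy) • a m - a ((MvPolynomial.X 1 : Rxy) • m)) = 0 :=
      fun m => LinearMap.congr_fun hab m
    have hc : Commute (E0 : Module.End ℂ (M × M)) E1 := by
      refine LinearMap.ext fun p => ?_
      refine Prod.ext ?_ ?_
      · exact smul_comm (MvPolynomial.X 0 : Rxy) (MvPolynomial.X 1 : Rxy) p.1
      · change a ((MvPolynomial.X 1 : Rxy) • p.1) +
          (MvPolynomial.X 0 : Rxy) • (b p.1 + (MvPolynomial.X 1 : Rxy) • p.2) =
          b ((MvPolynomial.X 0 : Rxy) • p.1) +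
          (MvPolynomial.X 1 : Rxy) • (a p.1 + (MvPolynomial.X 0 : Rxy) • p.2)
        rw [smul_add, smul_add, smul_comm (MvPolynomial.X 1 : Rxy) (MvPolynomial.X 0 : Rxy)]
        rw [← sub_eq_zero, ← hab' p.1]
        abel
    let T : Rxy →ₗ[ℂ] M × M := (MvPolynomial.basisMonomials (Fin 2) ℂ).constr ℂ
      (fun s => ((E0 : Module.End ℂ (M × M)) ^ s 0 * (E1 : Module.End ℂ (M × M)) ^ s 1) (π 1, 0))
    have hT : ∀ s, T (MvPolynomial.monomial s 1) =
        ((E0 : Module.End ℂ (M × M)) ^ s 0 * (E1 : Module.End ℂ (M × M)) ^ s 1) (π 1, 0) := by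
      intro s
      have h := Module.Basis.constr_basis (MvPolynomial.basisMonomials (Fin 2) ℂ) ℂ
        (fun s : Fin 2 →₀ ℕ =>
          ((E0 : Module.End ℂ (M × M)) ^ s 0 * (E1 : Module.End ℂ (M × M)) ^ s 1) (π 1, 0)) s
      rw [MvPolynomial.coe_basisMonomials] at h
      exact h
    have hT0 : ∀ f, T (MvPolynomial.X 0 * f) = E0 (T f) := by
      intro f
      refine LinearMap.congr_fun (f := T ∘ₗ LinearMap.mulLeft ℂ (MvPolynomial.X 0))
        (g := E0 ∘ₗ T) ?_ f
      refine (MvPolynomial.basisMonomials (Fin 2) ℂ).ext fun s => ?_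
      simp only [MvPolynomial.coe_basisMonomials, LinearMap.comp_apply, LinearMap.mulLeft_apply]
      rw [MvPolynomial.X, MvPolynomial.monomial_mul, one_mul, hT, hT]
      have e0 : (Finsupp.single 0 1 + s : Fin 2 →₀ ℕ) 0 = s 0 + 1 := by simp [add_comm]
      have e1 : (Finsupp.single 0 1 + s : Fin 2 →₀ ℕ) 1 = s 1 := by simp
      rw [e0, e1, pow_succ', mul_assoc]
      rfl
    have hT1 : ∀ f, T (MvPolynomial.X 1 * f) = E1 (T f) := by
      intro f
      refine LinearMap.congr_fun (f := T ∘ₗ LinearMap.mulLeft ℂ (MvPolynomial.X 1))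
        (g := E1 ∘ₗ T) ?_ f
      refine (MvPolynomial.basisMonomials (Fin 2) ℂ).ext fun s => ?_
      simp only [MvPolynomial.coe_basisMonomials, LinearMap.comp_apply, LinearMap.mulLeft_apply]
      rw [MvPolynomial.X, MvPolynomial.monomial_mul, one_mul, hT, hT]
      have e0 : (Finsupp.single 1 1 + s : Fin 2 →₀ ℕ) 0 = s 0 := by simp
      have e1 : (Finsupp.single 1 1 + s : Fin 2 →₀ ℕ) 1 = s 1 + 1 := by simp [add_comm]
      rw [e0, e1, pow_succ', ← mul_assoc, (hc.pow_left (s 0)).eq, mul_assoc]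
      rfl
    have hTone : T 1 = (π 1, 0) := by
      have := hT 0
      simpa using this
    have hfst : ∀ f, (T f).1 = π f := by
      intro f
      have := smul_lin (LinearMap.fst ℂ M M ∘ₗ T) (fun f => congrArg Prod.fst (hT0 f))
        (fun f => congrArg Prod.fst (hT1 f)) f
      have h2 : (T f).1 = f • (T 1).1 := this
      rw [h2, hTone, ← pi_smul, mul_one]
    let ψ : Rxy →ₗ[ℂ] M := LinearMap.snd ℂ M M ∘ₗ T
    have h2 : ∀ f, ψ (MvPolynomial.X 0 * f) = a (π f) + (MvPolynomial.X 0 : Rxy) • ψ f := by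
      intro f
      rw [← hfst]
      exact congrArg Prod.snd (hT0 f)
    have h3 : ∀ f, ψ (MvPolynomial.X 1 * f) = b (π f) + (MvPolynomial.X 1 : Rxy) • ψ f := by
      intro f
      rw [← hfst]
      exact congrArg Prod.snd (hT1 f)
    have hlin : ∀ (r f : Rxy), f ∈ I → ψ (r * f) = r • ψ f := by
      intro r f hf
      have h0 : ∀ g : Rxy, π (g * f) = 0 := fun g => (hI _).2 (I.mul_mem_left g hf)
      have h := smul_lin (ψ ∘ₗ LinearMap.mulRight ℂ f) (fun g => by
        simp only [LinearMap.comp_apply, LinearMap.mulRight_apply]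
        rw [mul_assoc, h2, h0, map_zero, zero_add]) (fun g => by
        simp only [LinearMap.comp_apply, LinearMap.mulRight_apply]
        rw [mul_assoc, h3, h0, map_zero, zero_add]) r
      simp only [LinearMap.comp_apply, LinearMap.mulRight_apply, one_mul] at h
      exact h
    let φ : I →ₗ[Rxy] M :=
      { toFun := fun f => ψ (f : Rxy)
        map_add' := fun f g => map_add ψ (f : Rxy) (g : Rxy)
        map_smul' := fun r f => hlin r f f.2 }
    exact ⟨⟨⟨ψ, φ, a, b⟩, fun f => rfl, h2, h3⟩, rfl⟩

lemma main_generic (n : ℕ) (I : Ideal Rxy) (π : Rxy →ₗ[Rxy] M) (hπ : Function.Surjective π)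
    (hk : ∀ f, π f = 0 ↔ f ∈ I) (hI : Module.rank ℂ M = (n : Cardinal)) :
    Module.rank ℂ (I →ₗ[Rxy] M) = ((2 * n : ℕ) : Cardinal) := by
  have : FiniteDimensional ℂ M :=
    Module.rank_lt_aleph0_iff.1 (hI ▸ Cardinal.natCast_lt_aleph0)
  have hn : Module.finrank ℂ M = n := Module.finrank_eq_of_rank_eq hI
  have h1 := LinearMap.rank_range_add_rank_ker (pH I π)
  have h2 := LinearMap.rank_range_add_rank_ker (pE I π)
  rw [rank_ker_pH I _ hπ hk, LinearMap.range_eq_top.2 (pH_surj I π hπ hk), rank_top] at h1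
  rw [rank_ker_pE, range_pE I _ hπ hk, hI, ← Module.finrank_eq_rank, finrank_ker_dd,
    ker_dz _ hπ, ← h1, hn, ← Module.finrank_eq_rank ℂ (M →ₗ[ℂ] M)] at h2
  generalize Module.finrank ℂ (M →ₗ[ℂ] M) = k at h2
  have h3 : Module.rank ℂ (I →ₗ[Rxy] M) + (k : Cardinal) =
    ((2 * n : ℕ) : Cardinal) + (k : Cardinal) := by
    rw [← h2]; norm_cast; ring
  exact Cardinal.eq_of_add_eq_add_right h3 Cardinal.natCast_lt_aleph0

end Main

/-- If `dim_ℂ(R/I) = n` then `dim_ℂ Hom_R(I, R/I) = 2n`. -/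
theorem statement6 (n : ℕ) (I : Ideal Rxy)
    (hI : Module.rank ℂ (Rxy ⧸ I) = (n : Cardinal)) :
    Module.rank ℂ (I →ₗ[Rxy] Rxy ⧸ I) = ((2 * n : ℕ) : Cardinal) := by
  have hπ : Function.Surjective (Submodule.mkQ I) := Submodule.mkQ_surjective I
  have hk : ∀ f, Submodule.mkQ I f = 0 ↔ f ∈ I := fun f => Submodule.Quotient.mk_eq_zero I
  exact main_generic n I (Submodule.mkQ I) hπ hk hI
end
end

section
/- Let R = ℂ[x,y] and let I₂ ⊆ I₁ be ideals of R with dim_ℂ(R/I₁) = n and dim_ℂ(R/I₂) = n+1. Then dim_ℂ T(I₁,I₂) = 2n+2. (This is the statement that the two-step flag Hilbert scheme Hilb^{n,n+1}(ℂ²), which has dimension 2n+2, is smooth.) -/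
/-!
Statement 7: for nested ideals I₂ ⊆ I₁ of R = ℂ[x,y] with dim_ℂ(R/I₁) = n and
dim_ℂ(R/I₂) = n+1, the tangent space T(I₁,I₂) of the two-step flag Hilbert scheme has
dimension 2n+2 (smoothness of Hilb^{n,n+1}(ℂ²)).
-/

set_option synthInstance.maxHeartbeats 1000000
set_option maxHeartbeats 1000000

noncomputable section

/-- The canonical surjection `R⧸I → R⧸J` for nested ideals `I ≤ J`, as an `R`-linear map. -/
def quotFactor {I J : Ideal Rxy} (h : I ≤ J) : (Rxy ⧸ I) →ₗ[Rxy] Rxy ⧸ J :=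
  Submodule.mapQ I J LinearMap.id h

/-- The Zariski tangent space `T(I₁,I₂)` of the two-step flag Hilbert scheme at a flag
`I₂ ≤ I₁`: the space of pairs `(f,h) ∈ Hom_R(I₁,R/I₁) × Hom_R(I₂,R/I₂)` such that
`f(a) = π(h(a))` for all `a ∈ I₂`, where `π : R/I₂ → R/I₁` is the canonical surjection. -/
def flagTangent2 (I₁ I₂ : Ideal Rxy) (h : I₂ ≤ I₁) :
    Submodule Rxy ((I₁ →ₗ[Rxy] Rxy ⧸ I₁) × (I₂ →ₗ[Rxy] Rxy ⧸ I₂)) :=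
  LinearMap.ker
    (((LinearMap.lcomp Rxy (Rxy ⧸ I₁) (Submodule.inclusion h)).comp
        (LinearMap.fst Rxy (I₁ →ₗ[Rxy] Rxy ⧸ I₁) (I₂ →ₗ[Rxy] Rxy ⧸ I₂)))
      - ((LinearMap.llcomp Rxy I₂ (Rxy ⧸ I₂) (Rxy ⧸ I₁) (quotFactor h)).comp
        (LinearMap.snd Rxy (I₁ →ₗ[Rxy] Rxy ⧸ I₁) (I₂ →ₗ[Rxy] Rxy ⧸ I₂))))

section LinAlg

variable {V W : Type} [AddCommGroup V] [Module ℂ V] [AddCommGroup W] [Module ℂ W]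

/-- Endomorphisms preserving `ker π`. -/
def parab (π : V →ₗ[ℂ] W) : Submodule ℂ (Module.End ℂ V) where
  carrier := {A | ∀ v, π v = 0 → π (A v) = 0}
  add_mem' := by
    intro a b ha hb v hv
    simp [ha v hv, hb v hv]
  zero_mem' := by intro v _; simp
  smul_mem' := by
    intro c a ha v hv
    simp [ha v hv]

/-- The linearized commutator. -/
def lcomm (π : V →ₗ[ℂ] W) (X Y : Module.End ℂ V) :
    (parab π × parab π) →ₗ[ℂ] Module.End ℂ V where
  toFun p := ((p.1 : Module.End ℂ V) * Y - Y * p.1) + (X * p.2 - p.2 * X)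
  map_add' := by
    intro a b
    simp only [Prod.fst_add, Prod.snd_add, Submodule.coe_add, add_mul, mul_add]
    abel
  map_smul' := by
    intro c a
    simp only [Prod.smul_fst, Prod.smul_snd, Submodule.coe_smul, smul_mul_assoc, mul_smul_comm,
      RingHom.id_apply, smul_add, smul_sub]

/-- Endomorphisms which are linear modulo `ker π`. -/
def linmod (π : V →ₗ[ℂ] W) (X Y : Module.End ℂ V) (X' Y' : Module.End ℂ W) :
    Submodule ℂ (Module.End ℂ V) where
  carrier := {C | (∀ v, π (C (X v)) = X' (π (C v))) ∧ ∀ v, π (C (Y v)) = Y' (π (C v))}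
  add_mem' := by
    intro a b ha hb
    exact ⟨fun v => by simp [ha.1 v, hb.1 v], fun v => by simp [ha.2 v, hb.2 v]⟩
  zero_mem' := by constructor <;> simp
  smul_mem' := by
    intro c a ha
    exact ⟨fun v => by simp [ha.1 v], fun v => by simp [ha.2 v]⟩

/-- The trace form. -/
def trForm (V : Type) [AddCommGroup V] [Module ℂ V] :
    LinearMap.BilinForm ℂ (Module.End ℂ V) :=
  (LinearMap.mul ℂ (Module.End ℂ V)).compr₂ (LinearMap.trace ℂ V)

theorem trForm_apply (A B : Module.End ℂ V) :
    trForm V A B = LinearMap.trace ℂ V (A * B) := rfl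

variable [FiniteDimensional ℂ V] [FiniteDimensional ℂ W]

theorem trForm_rankone (N : Module.End ℂ V) (φ : V →ₗ[ℂ] ℂ) (w : V) :
    LinearMap.trace ℂ V (N * φ.smulRight w) = φ (N w) := by
  have : N * φ.smulRight w = φ.smulRight (N w) := by
    ext v; simp
  rw [this, LinearMap.trace_smulRight]

theorem trForm_nondeg : (trForm V).Nondegenerate := by
  apply LinearMap.BilinForm.Nondegenerate.ofSeparatingLeft
  intro N hN
  ext w
  refine (Module.forall_dual_apply_eq_zero_iff ℂ (N w)).1 fun φ => ?_
  rw [← trForm_rankone]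
  exact hN _

theorem perp_parab (π : V →ₗ[ℂ] W) (N : Module.End ℂ V)
    (hN : ∀ A ∈ parab π, LinearMap.trace ℂ V (N * A) = 0) :
    (∀ v, π (N v) = 0) ∧ ∀ v, π v = 0 → N v = 0 := by
  constructor
  · intro v
    refine (Module.forall_dual_apply_eq_zero_iff ℂ _).1 fun φ => ?_
    have := hN ((φ ∘ₗ π).smulRight v) (by intro u hu; simp [hu])
    rwa [trForm_rankone] at this
  · intro v hv
    refine (Module.forall_dual_apply_eq_zero_iff ℂ _).1 fun φ => ?_
    have := hN (φ.smulRight v) (by intro u hu; simp [hv])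
    rwa [trForm_rankone] at this

theorem perp_parab' (π : V →ₗ[ℂ] W) (N : Module.End ℂ V)
    (h1 : ∀ v, π (N v) = 0) (h2 : ∀ v, π v = 0 → N v = 0)
    (A : Module.End ℂ V) (hA : A ∈ parab π) : LinearMap.trace ℂ V (N * A) = 0 := by
  have : IsNilpotent (N * A) := by
    refine ⟨2, ?_⟩
    ext v
    simp only [pow_two, Module.End.mul_apply, LinearMap.zero_apply]
    exact h2 _ (hA _ (h1 _))
  exact (LinearMap.isNilpotent_trace_of_isNilpotent this).eq_zero

theorem trace_comm1 (C A Y : Module.End ℂ V) :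
    LinearMap.trace ℂ V ((A * Y - Y * A) * C) = LinearMap.trace ℂ V ((Y * C - C * Y) * A) := by
  simp only [sub_mul, map_sub]
  rw [LinearMap.trace_mul_cycle ℂ A Y C, LinearMap.trace_mul_cycle ℂ Y A C,
    LinearMap.trace_mul_cycle ℂ C A Y]

theorem orth_eq (π : V →ₗ[ℂ] W) (X Y : Module.End ℂ V) (X' Y' : Module.End ℂ W)
    (hX : ∀ v, π (X v) = X' (π v)) (hY : ∀ v, π (Y v) = Y' (π v))
    (hL : Module.finrank ℂ (LinearMap.ker π) = 1)
    (hC : ∀ C ∈ linmod π X Y X' Y', C ∈ parab π) :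
    (trForm V).orthogonal (LinearMap.range (lcomm π X Y)) = linmod π X Y X' Y' := by
  have scal : ∀ C ∈ parab π, ∀ Z ∈ parab π, ∀ v, π v = 0 → Z (C v) - C (Z v) = 0 := by
    intro C hC Z hZ v hv
    by_cases hv0 : v = 0
    · simp [hv0]
    have key : ∀ w, π w = 0 → ∃ c : ℂ, c • v = w := by
      intro w hw
      obtain ⟨c, hc⟩ := exists_smul_eq_of_finrank_eq_one hL (x := ⟨v, hv⟩)
        (fun h0 => hv0 (congrArg Subtype.val h0)) ⟨w, hw⟩
      exact ⟨c, congrArg Subtype.val hc⟩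
    obtain ⟨c, hc⟩ := key _ (hC v hv)
    obtain ⟨d, hd⟩ := key _ (hZ v hv)
    rw [← hc, ← hd, map_smul, map_smul, ← hc, ← hd, smul_comm, sub_self]
  have hXP : X ∈ parab π := fun v hv => by rw [hX, hv, map_zero]
  have hYP : Y ∈ parab π := fun v hv => by rw [hY, hv, map_zero]
  ext C
  rw [LinearMap.BilinForm.mem_orthogonal_iff]
  constructor
  · intro h
    have hA : ∀ A ∈ parab π, LinearMap.trace ℂ V ((Y * C - C * Y) * A) = 0 := by
      intro A hA
      have := h _ ⟨(⟨A, hA⟩, 0), rfl⟩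
      rw [trForm_apply] at this
      rw [← trace_comm1]
      simpa [lcomm] using this
    have hB : ∀ A ∈ parab π, LinearMap.trace ℂ V ((X * C - C * X) * A) = 0 := by
      intro A hA
      have := h _ ⟨(0, ⟨A, hA⟩), rfl⟩
      rw [trForm_apply] at this
      rw [← trace_comm1, ← neg_eq_zero, ← map_neg, ← neg_mul, neg_sub]
      simpa [lcomm] using this
    constructor
    · intro v
      have := (perp_parab π _ hB).1 v
      simp [hX] at this
      rw [sub_eq_zero] at this
      exact this.symm
    · intro v
      have := (perp_parab π _ hA).1 v
      simp [hY] at this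
      rw [sub_eq_zero] at this
      exact this.symm
  · intro h
    have hCP := hC C h
    rintro _ ⟨⟨⟨A, hA⟩, ⟨B, hB⟩⟩, rfl⟩
    rw [trForm_apply]
    have e1 : LinearMap.trace ℂ V ((A * Y - Y * A) * C) = 0 := by
      rw [trace_comm1]
      apply perp_parab' π _ _ _ _ hA
      · intro v; simp [hY, h.2]
      · intro v hv; simpa using scal C hCP Y hYP v hv
    have e2 : LinearMap.trace ℂ V ((B * X - X * B) * C) = 0 := by
      rw [trace_comm1]
      apply perp_parab' π _ _ _ _ hB
      · intro v; simp [hX, h.1]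
      · intro v hv; simpa using scal C hCP X hXP v hv
    have : (lcomm π X Y (⟨A, hA⟩, ⟨B, hB⟩)) * C
        = (A * Y - Y * A) * C - (B * X - X * B) * C := by
      simp only [lcomm, LinearMap.coe_mk, AddHom.coe_mk]
      noncomm_ring
    rw [this, map_sub, e1, e2, sub_zero]

theorem finrank_parab (π : V →ₗ[ℂ] W) (hπ : Function.Surjective π)
    (hL : Module.finrank ℂ (LinearMap.ker π) = 1) :
    Module.finrank ℂ (parab π) + Module.finrank ℂ W
      = Module.finrank ℂ V * Module.finrank ℂ V := by
  let Φ : Module.End ℂ V →ₗ[ℂ] (LinearMap.ker π →ₗ[ℂ] W) :=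
    { toFun := fun A => π ∘ₗ A ∘ₗ (LinearMap.ker π).subtype
      map_add' := by intro a b; ext v; simp
      map_smul' := by intro a b; ext v; simp }
  have hs : Function.Surjective Φ := by
    intro g
    obtain ⟨s, hs⟩ := π.exists_rightInverse_of_surjective (LinearMap.range_eq_top.2 hπ)
    obtain ⟨g', hg'⟩ := g.exists_extend
    refine ⟨s ∘ₗ g', ?_⟩
    change π ∘ₗ (s ∘ₗ g') ∘ₗ (LinearMap.ker π).subtype = g
    rw [LinearMap.comp_assoc, ← LinearMap.comp_assoc, hs, LinearMap.id_comp, hg']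
  have hk : LinearMap.ker Φ = parab π := by
    ext A
    constructor
    · intro h v hv
      exact LinearMap.congr_fun h ⟨v, hv⟩
    · intro h
      ext v
      exact h v v.2
  have := Φ.finrank_range_add_finrank_ker
  rw [LinearMap.range_eq_top.2 hs, finrank_top, hk, Module.finrank_linearMap,
    Module.finrank_linearMap, hL] at this
  omega

theorem finrank_linmod (π : V →ₗ[ℂ] W)
    (X Y : Module.End ℂ V) (X' Y' : Module.End ℂ W) (v₀ : V)
    (hs : ∀ w, ∃ C ∈ linmod π X Y X' Y', π (C v₀) = w)
    (hi : ∀ C ∈ linmod π X Y X' Y', π (C v₀) = 0 → ∀ v, π (C v) = 0)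
    (hL : Module.finrank ℂ (LinearMap.ker π) = 1) :
    Module.finrank ℂ (linmod π X Y X' Y') = Module.finrank ℂ W + Module.finrank ℂ V := by
  let ev : linmod π X Y X' Y' →ₗ[ℂ] W :=
    { toFun := fun C => π ((C : Module.End ℂ V) v₀)
      map_add' := by intro a b; simp
      map_smul' := by intro a b; simp }
  let e : LinearMap.ker ev ≃ₗ[ℂ] (V →ₗ[ℂ] LinearMap.ker π) :=
    { toFun := fun C => LinearMap.codRestrict (LinearMap.ker π) (C.1 : Module.End ℂ V)
        (fun v => hi C.1.1 C.1.2 C.2 v)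
      invFun := fun f => ⟨⟨(LinearMap.ker π).subtype ∘ₗ f, by constructor <;> simp⟩, by
        simp [ev]⟩
      map_add' := by intro a b; rfl
      map_smul' := by intro a b; rfl
      left_inv := by intro C; rfl
      right_inv := by intro C; rfl }
  have h1 : Function.Surjective ev := fun w => by
    obtain ⟨C, hC, h⟩ := hs w
    exact ⟨⟨C, hC⟩, h⟩
  have := ev.finrank_range_add_finrank_ker
  rw [LinearMap.range_eq_top.2 h1, finrank_top, e.finrank_eq, Module.finrank_linearMap, hL] at this
  omega

theorem finrank_lifts {Z : Type} [AddCommGroup Z] [Module ℂ Z] (π : V →ₗ[ℂ] W)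
    (X Y : Module.End ℂ V) (Γ : Z →ₗ[ℂ] (parab π × parab π) × V) (hi : Function.Injective Γ)
    (hr' : ∀ q, (∃ z, Γ z = q) ↔ lcomm π X Y q.1 = 0) :
    FiniteDimensional ℂ Z ∧
      Module.finrank ℂ (LinearMap.range (lcomm π X Y)) + Module.finrank ℂ Z
        = Module.finrank ℂ (parab π) + Module.finrank ℂ (parab π) + Module.finrank ℂ V := by
  have hr : LinearMap.range Γ = LinearMap.ker (lcomm π X Y ∘ₗ LinearMap.fst ℂ _ V) := by
    ext q
    exact hr' q
  refine ⟨Module.Finite.of_injective Γ hi, ?_⟩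
  have dK := (lcomm π X Y ∘ₗ LinearMap.fst ℂ _ V).finrank_range_add_finrank_ker
  rw [LinearMap.range_comp_of_range_eq_top _ (LinearMap.range_eq_top.2 LinearMap.fst_surjective),
    ← hr, LinearMap.finrank_range_of_inj hi, Module.finrank_prod,
    Module.finrank_prod] at dK
  exact dK

end LinAlg
section Concrete

open MvPolynomial

/-- Multiplication by the `i`-th variable. -/
def mulE (M : Type) [AddCommGroup M] [Module ℂ M] [Module Rxy M] [IsScalarTower ℂ Rxy M]
    (i : Fin 2) : Module.End ℂ M :=
  Algebra.lsmul ℂ ℂ M (X i : Rxy)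

theorem mulE_apply (M : Type) [AddCommGroup M] [Module ℂ M] [Module Rxy M]
    [IsScalarTower ℂ Rxy M] (i : Fin 2) (m : M) : mulE M i m = (X i : Rxy) • m := rfl

/-- The projection as a `ℂ`-linear map. -/
def piC {I J : Ideal Rxy} (h : I ≤ J) : (Rxy ⧸ I) →ₗ[ℂ] Rxy ⧸ J :=
  (quotFactor h).restrictScalars ℂ

/-- The quotient map as a `ℂ`-linear map. -/
def mkC (I : Ideal Rxy) : Rxy →ₗ[ℂ] Rxy ⧸ I := (Submodule.mkQ I).restrictScalars ℂ

theorem mkC_surj (I : Ideal Rxy) : Function.Surjective (mkC I) := Submodule.mkQ_surjective I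

theorem mkC_eq_zero (I : Ideal Rxy) (p : Rxy) : mkC I p = 0 ↔ p ∈ I :=
  Submodule.Quotient.mk_eq_zero I

theorem mkC_mul (I : Ideal Rxy) (r p : Rxy) : mkC I (r * p) = r • mkC I p := rfl

theorem piC_mkC {I J : Ideal Rxy} (h : I ≤ J) (p : Rxy) : piC h (mkC I p) = mkC J p := rfl

theorem piC_smul {I J : Ideal Rxy} (h : I ≤ J) (r : Rxy) (v : Rxy ⧸ I) :
    piC h (r • v) = r • piC h v := (quotFactor h).map_smul r v

theorem piC_surj {I J : Ideal Rxy} (h : I ≤ J) : Function.Surjective (piC h) := by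
  intro w
  obtain ⟨p, rfl⟩ := mkC_surj J w
  exact ⟨mkC I p, rfl⟩

theorem lin_of_vars {M : Type} [AddCommGroup M] [Module ℂ M] [Module Rxy M]
    [IsScalarTower ℂ Rxy M] (I : Ideal Rxy) (g : Rxy →ₗ[ℂ] M)
    (hg : ∀ i, ∀ p ∈ I, g (X i * p) = (X i : Rxy) • g p) (r : Rxy) :
    ∀ p ∈ I, g (r * p) = r • g p := by
  induction r using MvPolynomial.induction_on with
  | C a =>
    intro p _
    rw [← MvPolynomial.smul_eq_C_mul, map_smul, ← algebraMap_smul Rxy a (g p)]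
    rfl
  | add r s hr hs =>
    intro p hp
    rw [add_mul, map_add, hr p hp, hs p hp, add_smul]
  | mul_X r i hr =>
    intro p hp
    rw [mul_assoc, hr _ (I.mul_mem_left _ hp), hg i p hp, mul_smul]

variable (I₁ I₂ : Ideal Rxy) (h : I₂ ≤ I₁)

/-- Failure of linearity in the `i`-th variable. -/
def sh (i : Fin 2) : (Rxy →ₗ[ℂ] Rxy ⧸ I₂) →ₗ[ℂ] (Rxy →ₗ[ℂ] Rxy ⧸ I₂) where
  toFun g := g ∘ₗ mulE Rxy i - mulE (Rxy ⧸ I₂) i ∘ₗ g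
  map_add' := by
    intro a b
    refine LinearMap.ext fun v => ?_
    simp only [LinearMap.sub_apply, LinearMap.add_apply, LinearMap.comp_apply, map_add]
    abel
  map_smul' := by
    intro c a
    refine LinearMap.ext fun v => ?_
    simp only [LinearMap.sub_apply, LinearMap.smul_apply, LinearMap.comp_apply, map_smul,
      smul_sub, RingHom.id_apply]

theorem sh_apply (i : Fin 2) (g : Rxy →ₗ[ℂ] Rxy ⧸ I₂) (p : Rxy) :
    sh I₂ i g p = g (X i * p) - (X i : Rxy) • g p := rfl

/-- Maps compatible with the zero tangent vector. -/
def parab' : Submodule ℂ (Rxy →ₗ[ℂ] Rxy ⧸ I₂) where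
  carrier := {a | (∀ p ∈ I₂, a p = 0) ∧ ∀ p ∈ I₁, piC h (a p) = 0}
  add_mem' := by
    intro a b ha hb
    exact ⟨fun p hp => by simp [ha.1 p hp, hb.1 p hp],
      fun p hp => by simp [ha.2 p hp, hb.2 p hp]⟩
  zero_mem' := by constructor <;> simp
  smul_mem' := by
    intro c a ha
    exact ⟨fun p hp => by simp [ha.1 p hp], fun p hp => by simp [ha.2 p hp]⟩

/-- Lifts of tangent vectors. -/
def liftZ : Submodule ℂ (Rxy →ₗ[ℂ] Rxy ⧸ I₂) :=
  (parab' I₁ I₂ h).comap (sh I₂ 0) ⊓ (parab' I₁ I₂ h).comap (sh I₂ 1)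

theorem liftZ_sh {g : Rxy →ₗ[ℂ] Rxy ⧸ I₂} (hg : g ∈ liftZ I₁ I₂ h) (i : Fin 2) :
    sh I₂ i g ∈ parab' I₁ I₂ h := by
  fin_cases i
  · exact hg.1
  · exact hg.2

theorem liftZ_lin2 {g : Rxy →ₗ[ℂ] Rxy ⧸ I₂} (hg : g ∈ liftZ I₁ I₂ h) (r : Rxy) :
    ∀ p ∈ I₂, g (r * p) = r • g p := by
  apply lin_of_vars
  intro i p hp
  exact sub_eq_zero.1 ((liftZ_sh I₁ I₂ h hg i).1 p hp)

theorem liftZ_lin1 {g : Rxy →ₗ[ℂ] Rxy ⧸ I₂} (hg : g ∈ liftZ I₁ I₂ h) (r : Rxy) :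
    ∀ p ∈ I₁, piC h (g (r * p)) = r • piC h (g p) := by
  refine lin_of_vars I₁ (piC h ∘ₗ g) ?_ r
  intro i p hp
  have := (liftZ_sh I₁ I₂ h hg i).2 p hp
  rw [sh_apply, map_sub, piC_smul] at this
  exact sub_eq_zero.1 this

/-- The map from lifts to tangent vectors. -/
def toT : liftZ I₁ I₂ h →ₗ[ℂ] flagTangent2 I₁ I₂ h where
  toFun g := ⟨({ toFun := fun p => piC h (g.1 p)
                 map_add' := by intro a b; simp
                 map_smul' := by
                  intro r p
                  exact liftZ_lin1 I₁ I₂ h g.2 r p p.2 },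
               { toFun := fun p => g.1 p
                 map_add' := by intro a b; simp
                 map_smul' := by
                  intro r p
                  exact liftZ_lin2 I₁ I₂ h g.2 r p p.2 }), by
      rw [flagTangent2, LinearMap.mem_ker]
      ext p
      simp only [LinearMap.sub_apply]
      exact sub_self _⟩
  map_add' := by
    intro a b
    apply Subtype.ext
    apply Prod.ext <;> ext p <;> simp
  map_smul' := by
    intro a b
    apply Subtype.ext
    apply Prod.ext <;> ext p <;> simp

theorem toT_surj : Function.Surjective (toT I₁ I₂ h) := by
  rintro ⟨⟨f, k⟩, hfk⟩
  have hcomp : ∀ p (hp : p ∈ I₂), f ⟨p, h hp⟩ = piC h (k ⟨p, hp⟩) := by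
    intro p hp
    rw [flagTangent2, LinearMap.mem_ker] at hfk
    exact sub_eq_zero.1 (LinearMap.congr_fun hfk ⟨p, hp⟩)
  obtain ⟨s, hs⟩ := (piC h).exists_rightInverse_of_surjective
    (LinearMap.range_eq_top.2 (piC_surj h))
  obtain ⟨f', hf'⟩ := LinearMap.exists_extend (p := I₁.restrictScalars ℂ) (f.restrictScalars ℂ)
  have hs' : ∀ w, piC h (s w) = w := fun w => LinearMap.congr_fun hs w
  have hf1 : ∀ p (hp : p ∈ I₁), f' p = f ⟨p, hp⟩ :=
    fun p hp => LinearMap.congr_fun hf' ⟨p, hp⟩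
  let k₀ : I₂.restrictScalars ℂ →ₗ[ℂ] Rxy ⧸ I₂ := k.restrictScalars ℂ
  let d : I₂.restrictScalars ℂ →ₗ[ℂ] LinearMap.ker (piC h) :=
    LinearMap.codRestrict _
      (k₀ - s ∘ₗ f' ∘ₗ (I₂.restrictScalars ℂ).subtype) (by
      rintro ⟨p, hp⟩
      have hp' : p ∈ I₂ := hp
      rw [LinearMap.mem_ker, LinearMap.sub_apply, map_sub]
      change piC h (k ⟨p, hp'⟩) - piC h (s (f' p)) = 0
      rw [hs', hf1 p (h hp'), hcomp p hp', sub_self])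
  obtain ⟨d', hd'⟩ := d.exists_extend
  let g : Rxy →ₗ[ℂ] Rxy ⧸ I₂ := s ∘ₗ f' + (LinearMap.ker (piC h)).subtype ∘ₗ d'
  have g1 : ∀ p (hp : p ∈ I₁), piC h (g p) = f ⟨p, hp⟩ := by
    intro p hp
    have : piC h (d' p : Rxy ⧸ I₂) = 0 := (d' p).2
    simp [g, this, hs', hf1 p hp]
  have g2 : ∀ p (hp : p ∈ I₂), g p = k ⟨p, hp⟩ := by
    intro p hp
    have : (d' p : Rxy ⧸ I₂) = k ⟨p, hp⟩ - s (f' p) :=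
      congrArg Subtype.val (LinearMap.congr_fun hd' ⟨p, hp⟩)
    simp [g, this]
  have hg : ∀ i, sh I₂ i g ∈ parab' I₁ I₂ h := by
    intro i
    constructor
    · intro p hp
      rw [sh_apply, g2 p hp, g2 _ (I₂.mul_mem_left _ hp), ← map_smul, sub_eq_zero]
      rfl
    · intro p hp
      rw [sh_apply, map_sub, piC_smul, g1 p hp, g1 _ (I₁.mul_mem_left _ hp), ← map_smul,
        sub_eq_zero]
      rfl
  refine ⟨⟨g, hg 0, hg 1⟩, ?_⟩
  apply Subtype.ext
  apply Prod.ext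
  · ext p
    exact g1 p p.2
  · ext p
    exact g2 p p.2

theorem parab'_le : parab' I₁ I₂ h ≤ liftZ I₁ I₂ h := by
  intro a ha
  have : ∀ i, sh I₂ i a ∈ parab' I₁ I₂ h := by
    intro i
    constructor
    · intro p hp
      rw [sh_apply, ha.1 p hp, ha.1 _ (I₂.mul_mem_left _ hp), smul_zero, sub_zero]
    · intro p hp
      rw [sh_apply, map_sub, piC_smul, ha.2 p hp, ha.2 _ (I₁.mul_mem_left _ hp), smul_zero,
        sub_zero]
  exact ⟨this 0, this 1⟩

theorem toT_ker : LinearMap.ker (toT I₁ I₂ h)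
    = (parab' I₁ I₂ h).comap (liftZ I₁ I₂ h).subtype := by
  ext g
  constructor
  · intro hg
    have hg' := congrArg Subtype.val (LinearMap.mem_ker.1 hg)
    constructor
    · intro p hp
      exact LinearMap.congr_fun (congrArg Prod.snd hg') ⟨p, hp⟩
    · intro p hp
      exact LinearMap.congr_fun (congrArg Prod.fst hg') ⟨p, hp⟩
  · intro hg
    rw [LinearMap.mem_ker]
    apply Subtype.ext
    apply Prod.ext
    · ext p
      exact hg.2 p p.2
    · ext p
      exact hg.1 p p.2

theorem comp_mkC_mem (A : parab (piC h)) :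
    (A : Module.End ℂ (Rxy ⧸ I₂)) ∘ₗ mkC I₂ ∈ parab' I₁ I₂ h := by
  constructor
  · intro p hp
    rw [LinearMap.comp_apply, (mkC_eq_zero I₂ p).2 hp, map_zero]
  · intro p hp
    refine A.2 _ ?_
    rw [piC_mkC, mkC_eq_zero]
    exact hp

/-- Pullback to the polynomial ring. -/
def pullP : parab (piC h) →ₗ[ℂ] parab' I₁ I₂ h where
  toFun A := ⟨(A : Module.End ℂ (Rxy ⧸ I₂)) ∘ₗ mkC I₂, comp_mkC_mem I₁ I₂ h A⟩
  map_add' := by intro a b; rfl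
  map_smul' := by intro a b; rfl

theorem pullP_bij : Function.Bijective (pullP I₁ I₂ h) := by
  constructor
  · intro A B hAB
    apply Subtype.ext
    refine LinearMap.ext fun v => ?_
    obtain ⟨p, rfl⟩ := mkC_surj I₂ v
    exact LinearMap.congr_fun (congrArg Subtype.val hAB) p
  · rintro ⟨a, ha⟩
    refine ⟨⟨Submodule.liftQ (I₂.restrictScalars ℂ) a (fun p hp => ha.1 p hp), ?_⟩, ?_⟩
    · intro v hv
      obtain ⟨p, rfl⟩ := mkC_surj I₂ v
      rw [piC_mkC, mkC_eq_zero] at hv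
      exact ha.2 p hv
    · rfl

/-- Descent to the quotient. -/
def eP : parab (piC h) ≃ₗ[ℂ] parab' I₁ I₂ h :=
  LinearEquiv.ofBijective (pullP I₁ I₂ h) (pullP_bij I₁ I₂ h)

theorem eP_symm_apply (a : parab' I₁ I₂ h) (p : Rxy) :
    (((eP I₁ I₂ h).symm a : parab (piC h)) : Module.End ℂ (Rxy ⧸ I₂)) (mkC I₂ p) = a.1 p := by
  have : (eP I₁ I₂ h) ((eP I₁ I₂ h).symm a) = a := LinearEquiv.apply_symm_apply _ _
  exact LinearMap.congr_fun (congrArg Subtype.val this) p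


theorem exists_rec {M : Type} [AddCommGroup M] [Module ℂ M] (S T : Module.End ℂ M)
    (hST : S * T = T * S) (m : M) :
    ∃ F : Rxy →ₗ[ℂ] M, F 1 = m ∧ (∀ p, F (X 0 * p) = S (F p)) ∧ ∀ p, F (X 1 * p) = T (F p) := by
  let b := MvPolynomial.basisMonomials (Fin 2) ℂ
  let F : Rxy →ₗ[ℂ] M := b.constr ℂ (fun e => (S ^ (e 0) * T ^ (e 1)) m)
  have hF : ∀ e : Fin 2 →₀ ℕ, F (monomial e 1) = (S ^ (e 0) * T ^ (e 1)) m := by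
    intro e
    have : (monomial e 1 : Rxy) = b e := by simp [b]
    rw [this]
    exact b.constr_basis ℂ _ e
  have hc : Commute S T := hST
  refine ⟨F, ?_, ?_, ?_⟩
  · have := hF 0
    simpa using this
  · have : F ∘ₗ mulE Rxy 0 = S ∘ₗ F := by
      refine b.ext fun e => ?_
      have hb : b e = monomial e 1 := by simp [b]
      rw [hb, LinearMap.comp_apply, LinearMap.comp_apply, mulE_apply, smul_eq_mul, X,
        monomial_mul, one_mul, hF, hF]
      simp [add_comm 1, pow_succ', ← Module.End.mul_apply, mul_assoc]
    exact fun p => LinearMap.congr_fun this p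
  · have : F ∘ₗ mulE Rxy 1 = T ∘ₗ F := by
      refine b.ext fun e => ?_
      have hb : b e = monomial e 1 := by simp [b]
      rw [hb, LinearMap.comp_apply, LinearMap.comp_apply, mulE_apply, smul_eq_mul, X,
        monomial_mul, one_mul, hF, hF, ← Module.End.mul_apply, ← mul_assoc,
        ← (hc.pow_left (e 0)).eq, mul_assoc, ← pow_succ']
      simp [add_comm 1]
    exact fun p => LinearMap.congr_fun this p

theorem exists_lift (A B : Module.End ℂ (Rxy ⧸ I₂))
    (hAB : (A * mulE _ 1 - mulE _ 1 * A) + (mulE _ 0 * B - B * mulE _ 0) = 0)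
    (u : Rxy ⧸ I₂) :
    ∃ g : Rxy →ₗ[ℂ] Rxy ⧸ I₂, g 1 = u ∧
      (∀ p, g (X 0 * p) = (X 0 : Rxy) • g p + A (mkC I₂ p)) ∧
      (∀ p, g (X 1 * p) = (X 1 : Rxy) • g p + B (mkC I₂ p)) := by
  let op : Fin 2 → Module.End ℂ (Rxy ⧸ I₂) → Module.End ℂ ((Rxy ⧸ I₂) × (Rxy ⧸ I₂)) :=
    fun i D => (mulE (Rxy ⧸ I₂) i ∘ₗ LinearMap.fst ℂ _ _).prod
      (mulE (Rxy ⧸ I₂) i ∘ₗ LinearMap.snd ℂ _ _ + D ∘ₗ LinearMap.fst ℂ _ _)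
  have op1 : ∀ i D q, (op i D q).1 = (X i : Rxy) • q.1 := fun i D q => rfl
  have op2 : ∀ i D q, (op i D q).2 = (X i : Rxy) • q.2 + D q.1 := fun i D q => rfl
  obtain ⟨F, F1, FX, FY⟩ := exists_rec (op 0 A) (op 1 B) (by
    refine LinearMap.ext fun q => ?_
    have := LinearMap.congr_fun hAB q.1
    simp only [LinearMap.add_apply, LinearMap.sub_apply, Module.End.mul_apply, mulE_apply,
      LinearMap.zero_apply] at this
    rw [Module.End.mul_apply, Module.End.mul_apply]
    apply Prod.ext
    · rw [op1, op1, op1, op1, smul_comm]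
    · rw [op2, op2, op2, op2, op1, op1, smul_add, smul_add,
        smul_comm (X 0 : Rxy) (X 1 : Rxy) q.2, ← sub_eq_zero, ← this]
      abel) (mkC I₂ 1, u)
  have hfst : ∀ p, (F p).1 = mkC I₂ p := by
    intro p
    have := lin_of_vars ⊤ (LinearMap.fst ℂ _ _ ∘ₗ F) (by
      intro i p _
      fin_cases i
      · change (F (X 0 * p)).1 = (X 0 : Rxy) • (F p).1
        rw [FX, op1]
      · change (F (X 1 * p)).1 = (X 1 : Rxy) • (F p).1
        rw [FY, op1]) p 1 trivial
    rw [mul_one] at this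
    change (F p).1 = p • (F 1).1 at this
    rw [this, F1, ← mkC_mul, mul_one]
  refine ⟨LinearMap.snd ℂ _ _ ∘ₗ F, ?_, ?_, ?_⟩
  · change (F 1).2 = u
    rw [F1]
  · intro p
    change (F (X 0 * p)).2 = (X 0 : Rxy) • (F p).2 + _
    rw [FX, op2, hfst]
  · intro p
    change (F (X 1 * p)).2 = (X 1 : Rxy) • (F p).2 + _
    rw [FY, op2, hfst]

/-- Failure of linearity, on lifts. -/
def shZ (i : Fin 2) : liftZ I₁ I₂ h →ₗ[ℂ] parab' I₁ I₂ h where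
  toFun g := ⟨sh I₂ i g.1, liftZ_sh I₁ I₂ h g.2 i⟩
  map_add' a b := Subtype.ext (map_add (sh I₂ i) a.1 b.1)
  map_smul' c a := Subtype.ext (map_smul (sh I₂ i) c a.1)

/-- The ADHM-type data of a lift. -/
def adhm : liftZ I₁ I₂ h →ₗ[ℂ] (parab (piC h) × parab (piC h)) × (Rxy ⧸ I₂) where
  toFun g := (((eP I₁ I₂ h).symm (shZ I₁ I₂ h 0 g), (eP I₁ I₂ h).symm (shZ I₁ I₂ h 1 g)), g.1 1)
  map_add' := by
    intro a b
    refine Prod.ext (Prod.ext ?_ ?_) rfl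
    · simp only [map_add, Prod.fst_add]
    · simp only [map_add, Prod.fst_add, Prod.snd_add]
  map_smul' := by
    intro c a
    refine Prod.ext (Prod.ext ?_ ?_) rfl
    · simp only [map_smul, Prod.smul_fst, RingHom.id_apply]
    · simp only [map_smul, Prod.smul_fst, Prod.smul_snd, RingHom.id_apply]

theorem adhm_inj : Function.Injective (adhm I₁ I₂ h) := by
  rw [injective_iff_map_eq_zero]
  intro g hg
  have h0 : sh I₂ 0 g.1 = 0 := by
    have := congrArg (fun q => q.1.1) hg
    exact congrArg Subtype.val ((LinearEquiv.map_eq_zero_iff (eP I₁ I₂ h).symm).1 this)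
  have h1 : sh I₂ 1 g.1 = 0 := by
    have := congrArg (fun q => q.1.2) hg
    exact congrArg Subtype.val ((LinearEquiv.map_eq_zero_iff (eP I₁ I₂ h).symm).1 this)
  have h2 : g.1 1 = 0 := congrArg (fun q => q.2) hg
  apply Subtype.ext
  refine LinearMap.ext fun p => ?_
  have := lin_of_vars ⊤ g.1 (by
    intro i p _
    fin_cases i
    · exact sub_eq_zero.1 (LinearMap.congr_fun h0 p)
    · exact sub_eq_zero.1 (LinearMap.congr_fun h1 p)) p 1 trivial
  rw [mul_one, h2, smul_zero] at this
  exact this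

theorem adhm_range : LinearMap.range (adhm I₁ I₂ h)
    = LinearMap.ker (lcomm (piC h) (mulE _ 0) (mulE _ 1) ∘ₗ LinearMap.fst ℂ _ (Rxy ⧸ I₂)) := by
  ext ⟨⟨A, B⟩, u⟩
  constructor
  · rintro ⟨g, hg⟩
    rw [← hg, LinearMap.mem_ker]
    refine LinearMap.ext fun v => ?_
    obtain ⟨p, rfl⟩ := mkC_surj I₂ v
    have e0 : ∀ p, (((adhm I₁ I₂ h g).1.1 : parab (piC h)) : Module.End ℂ (Rxy ⧸ I₂)) (mkC I₂ p)
        = g.1 (X 0 * p) - (X 0 : Rxy) • g.1 p := fun p => eP_symm_apply I₁ I₂ h _ p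
    have e1 : ∀ p, (((adhm I₁ I₂ h g).1.2 : parab (piC h)) : Module.End ℂ (Rxy ⧸ I₂)) (mkC I₂ p)
        = g.1 (X 1 * p) - (X 1 : Rxy) • g.1 p := fun p => eP_symm_apply I₁ I₂ h _ p
    change (((adhm I₁ I₂ h g).1.1 : Module.End ℂ (Rxy ⧸ I₂)) (mkC I₂ (X 1 * p))
      - (X 1 : Rxy) • ((adhm I₁ I₂ h g).1.1 : Module.End ℂ (Rxy ⧸ I₂)) (mkC I₂ p))
      + ((X 0 : Rxy) • ((adhm I₁ I₂ h g).1.2 : Module.End ℂ (Rxy ⧸ I₂)) (mkC I₂ p)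
      - ((adhm I₁ I₂ h g).1.2 : Module.End ℂ (Rxy ⧸ I₂)) (mkC I₂ (X 0 * p))) = 0
    rw [e0, e0, e1, e1, smul_sub, smul_sub, smul_comm (X 0 : Rxy) (X 1 : Rxy) (g.1 p),
      mul_left_comm (X 0 : Rxy) (X 1) p]
    abel
  · intro hk
    obtain ⟨g, g1, gX, gY⟩ := exists_lift I₂ A B (LinearMap.mem_ker.1 hk) u
    have s0 : sh I₂ 0 g = (eP I₁ I₂ h A).1 := by
      refine LinearMap.ext fun p => ?_
      rw [sh_apply, gX, add_sub_cancel_left]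
      rfl
    have s1 : sh I₂ 1 g = (eP I₁ I₂ h B).1 := by
      refine LinearMap.ext fun p => ?_
      rw [sh_apply, gY, add_sub_cancel_left]
      rfl
    have m0 : sh I₂ 0 g ∈ parab' I₁ I₂ h := by rw [s0]; exact Subtype.prop _
    have m1 : sh I₂ 1 g ∈ parab' I₁ I₂ h := by rw [s1]; exact Subtype.prop _
    refine ⟨⟨g, m0, m1⟩, ?_⟩
    refine Prod.ext (Prod.ext ?_ ?_) g1
    · change (eP I₁ I₂ h).symm _ = A
      rw [LinearEquiv.symm_apply_eq]
      exact Subtype.ext s0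
    · change (eP I₁ I₂ h).symm _ = B
      rw [LinearEquiv.symm_apply_eq]
      exact Subtype.ext s1

theorem linmod_apply (C : Module.End ℂ (Rxy ⧸ I₂))
    (hC : C ∈ linmod (piC h) (mulE _ 0) (mulE _ 1) (mulE _ 0) (mulE _ 1)) (p : Rxy) :
    piC h (C (mkC I₂ p)) = p • piC h (C (mkC I₂ 1)) := by
  have := lin_of_vars ⊤ (piC h ∘ₗ C ∘ₗ mkC I₂) (by
    intro i p _
    fin_cases i
    · exact hC.1 (mkC I₂ p)
    · exact hC.2 (mkC I₂ p)) p 1 trivial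
  rw [mul_one] at this
  exact this

end Concrete

/-- If `dim_ℂ(R/I₁) = n` and `dim_ℂ(R/I₂) = n+1` then `dim_ℂ T(I₁,I₂) = 2n+2`. -/
theorem statement7 (n : ℕ) (I₁ I₂ : Ideal Rxy) (h : I₂ ≤ I₁)
    (h1 : Module.rank ℂ (Rxy ⧸ I₁) = (n : Cardinal))
    (h2 : Module.rank ℂ (Rxy ⧸ I₂) = ((n + 1 : ℕ) : Cardinal)) :
    Module.rank ℂ ↥(flagTangent2 I₁ I₂ h) = ((2 * n + 2 : ℕ) : Cardinal) := by
  have f1 : Module.finrank ℂ (Rxy ⧸ I₁) = n := Module.finrank_eq_of_rank_eq h1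
  have f2 : Module.finrank ℂ (Rxy ⧸ I₂) = n + 1 := Module.finrank_eq_of_rank_eq h2
  have : FiniteDimensional ℂ (Rxy ⧸ I₁) :=
    Module.rank_lt_aleph0_iff.1 (by rw [h1]; exact Cardinal.natCast_lt_aleph0)
  have : FiniteDimensional ℂ (Rxy ⧸ I₂) :=
    Module.rank_lt_aleph0_iff.1 (by rw [h2]; exact Cardinal.natCast_lt_aleph0)
  have hL : Module.finrank ℂ (LinearMap.ker (piC h)) = 1 := by
    have := (piC h).finrank_range_add_finrank_ker
    rw [LinearMap.range_eq_top.2 (piC_surj h), finrank_top, f1, f2] at this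
    omega
  have dP := finrank_parab (piC h) (piC_surj h) hL
  have dO := finrank_linmod (piC h) (mulE _ 0) (mulE _ 1) (mulE _ 0) (mulE _ 1) (mkC I₂ 1)
    (by
      intro w
      obtain ⟨c, rfl⟩ := mkC_surj I₁ w
      refine ⟨Algebra.lsmul ℂ ℂ (Rxy ⧸ I₂) c, ⟨fun v => ?_, fun v => ?_⟩, ?_⟩
      · change piC h (c • (MvPolynomial.X 0 : Rxy) • v)
          = (MvPolynomial.X 0 : Rxy) • piC h (c • v)
        rw [smul_comm, piC_smul]
      · change piC h (c • (MvPolynomial.X 1 : Rxy) • v)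
          = (MvPolynomial.X 1 : Rxy) • piC h (c • v)
        rw [smul_comm, piC_smul]
      · change piC h (c • mkC I₂ 1) = _
        rw [← mkC_mul, mul_one, piC_mkC])
    (by
      intro C hC h0 v
      obtain ⟨p, rfl⟩ := mkC_surj I₂ v
      rw [linmod_apply I₁ I₂ h C hC, h0, smul_zero]) hL
  have horth := orth_eq (piC h) (mulE _ 0) (mulE _ 1) (mulE _ 0) (mulE _ 1)
    (fun v => piC_smul h _ v) (fun v => piC_smul h _ v) hL
    (by
      intro C hC v hv
      obtain ⟨p, rfl⟩ := mkC_surj I₂ v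
      rw [piC_mkC, mkC_eq_zero] at hv
      rw [linmod_apply I₁ I₂ h C hC]
      obtain ⟨q, hq⟩ := mkC_surj I₁ (piC h (C (mkC I₂ 1)))
      rw [← hq, ← mkC_mul, mkC_eq_zero]
      exact I₁.mul_mem_right _ hv)
  have dU := LinearMap.BilinForm.finrank_orthogonal (trForm_nondeg (V := Rxy ⧸ I₂))
    (LinearMap.range (lcomm (piC h) (mulE _ 0) (mulE _ 1)))
  have leU := Submodule.finrank_le
    (LinearMap.range (lcomm (piC h) (mulE (Rxy ⧸ I₂) 0) (mulE (Rxy ⧸ I₂) 1)))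
  rw [horth, dO] at dU
  rw [Module.finrank_linearMap] at dU leU
  obtain ⟨fZ, dK⟩ := finrank_lifts (Z := liftZ I₁ I₂ h) (piC h) (mulE _ 0) (mulE _ 1) (adhm I₁ I₂ h)
    (adhm_inj I₁ I₂ h) (by
      intro q
      exact SetLike.ext_iff.1 (adhm_range I₁ I₂ h) q)
  have fT : FiniteDimensional ℂ (flagTangent2 I₁ I₂ h) :=
    Module.Finite.of_surjective (toT I₁ I₂ h) (toT_surj I₁ I₂ h)
  have dT := LinearMap.finrank_range_add_finrank_ker (K := ℂ) (V := liftZ I₁ I₂ h)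
    (V₂ := flagTangent2 I₁ I₂ h) (toT I₁ I₂ h)
  rw [LinearMap.range_eq_top.2 (toT_surj I₁ I₂ h), finrank_top, toT_ker,
    (Submodule.comapSubtypeEquivOfLe (parab'_le I₁ I₂ h)).finrank_eq,
    ← (eP I₁ I₂ h).finrank_eq] at dT
  rw [← Module.finrank_eq_rank]
  congr 1
  rw [f1, f2] at *
  have : (n + 1) * (n + 1) = n * n + 2 * n + 1 := by ring
  rw [this] at *
  omega
end
end

section
/- For all natural numbers n and k, the number of Young diagrams Γ with n boxes having exactly k nonempty columns equals the number of Young diagrams Γ with n boxes having exactly k boxes whose hook difference lies in {0,1}; equivalently ∑_{Γ⊢n} q^{n−ℓ(Γ)} = ∑_{Γ⊢n} q^{n−#{(u,v)∈Γ : h_{u,v}(Γ)∈{0,1}}} as polynomials in q. -/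
/-!
Statement 8: for all n, k, the number of Young diagrams with n boxes and k nonempty
columns equals the number of Young diagrams with n boxes having exactly k boxes whose
hook difference lies in {0,1}.
-/

/-- The number of nonempty columns of a Young diagram. -/
def ell (Γ : YoungDiagram) : ℕ := (Γ.cells.filter fun c => c.2 = 0).card

/-- The hook difference of a box `c` with respect to a finite set `s` of boxes. -/
def hookDiff (s : Finset (ℕ × ℕ)) (c : ℕ × ℕ) : ℤ :=
  ((s.filter fun d => d.2 = c.2 ∧ c.1 < d.1).card : ℤ)
    - ((s.filter fun d => d.1 = c.1 ∧ c.2 < d.2).card : ℤ)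

namespace LW

open Polynomial

/-- q-binomial -/
noncomputable def qb : ℕ → ℕ → ℤ[X]
  | 0, _ => 1
  | _ + 1, 0 => 1
  | a + 1, b + 1 => X ^ (b + 1) * qb a (b + 1) + qb (a + 1) b

noncomputable def qi (n : ℕ) : ℤ[X] := ∑ i ∈ Finset.range n, X ^ i

noncomputable def qf (n : ℕ) : ℤ[X] := ∏ i ∈ Finset.range n, qi (i + 1)

lemma qi_add (a b : ℕ) : qi (a + b) = X ^ b * qi a + qi b := by
  unfold qi
  rw [add_comm a b, Finset.sum_range_add, Finset.mul_sum]
  simp [pow_add, add_comm]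

lemma qf_succ (n : ℕ) : qf (n + 1) = qf n * qi (n + 1) := by
  unfold qf; rw [Finset.prod_range_succ]

lemma qf_zero : qf 0 = 1 := by simp [qf]

lemma qb_zero_right (a : ℕ) : qb a 0 = 1 := by cases a <;> simp [qb]

lemma qb_zero_left (a : ℕ) : qb 0 a = 1 := by simp [qb]

lemma qb_fact : ∀ a b : ℕ, qb a b * (qf a * qf b) = qf (a + b)
  | 0, b => by simp [qb, qf_zero]
  | a + 1, 0 => by simp [qb, qf_zero]
  | a + 1, b + 1 => by
    have h1 := qb_fact a (b + 1)
    have h2 := qb_fact (a + 1) b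
    have e : a + 1 + (b + 1) = (a + 1 + b) + 1 := by omega
    have e1 : a + (b + 1) = a + 1 + b := by omega
    have e2 : a + 1 + b + 1 = (a + 1) + (b + 1) := by omega
    have h3 : qf (a + 1 + (b + 1)) = qf (a + 1 + b) * (X ^ (b + 1) * qi (a + 1) + qi (b + 1)) := by
      rw [e, qf_succ, e2, qi_add]
    rw [h3]
    rw [e1] at h1
    rw [qb, qf_succ a, qf_succ b]
    rw [qf_succ b] at h1
    rw [qf_succ a] at h2
    linear_combination (X ^ (b + 1) * qi (a + 1)) * h1 + qi (b + 1) * h2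

lemma qi_ne (n : ℕ) : qi (n + 1) ≠ 0 := by
  intro h
  have := congrArg (fun p => p.eval 1) h
  simp [qi, eval_finsetSum] at this
  omega

lemma qf_ne (n : ℕ) : qf n ≠ 0 := by
  unfold qf
  exact Finset.prod_ne_zero_iff.mpr fun i _ => qi_ne i

lemma qb_pascal (a b : ℕ) (h : 0 < a + b) :
    qb a b = (if 0 < a then X ^ b * qb (a - 1) b else 0) + (if 0 < b then qb a (b - 1) else 0) := by
  rcases a with _ | a <;> rcases b with _ | b
  · simp at h
  · simp [qb]
  · simp [qb, qb_zero_right]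
  · simp [qb]

abbrev E := Bool × ℤ →₀ ℕ

def stp (s r : ℤ) : Bool → ℤ → ℤ
  | true, v => v + s
  | false, v => v - r

noncomputable def edges (s r : ℤ) : List Bool → ℤ → E
  | [], _ => 0
  | b :: l, v => Finsupp.single (b, v) 1 + edges s r l (stp s r b v)

def endp (s r : ℤ) : List Bool → ℤ → ℤ
  | [], v => v
  | b :: l, v => endp s r l (stp s r b v)

noncomputable def Bst (s r : ℤ) : List Bool → ℤ → ℕ
  | [], _ => 0
  | true :: l, v => edges s r l (v + s) (false, v) + Bst s r l (v + s)
  | false :: l, v => Bst s r l (v - r)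

noncomputable def W (s r : ℤ) : ℕ → E → ℤ → ℤ[X]
  | 0, m, v => if m = 0 ∧ v = 0 then 1 else 0
  | n + 1, m, v =>
    (if 0 < m (true, v) then
      X ^ (m (false, v)) * W s r n (m - Finsupp.single (true, v) 1) (v + s) else 0) +
    (if 0 < m (false, v) then W s r n (m - Finsupp.single (false, v) 1) (v - r) else 0)

def lists : ℕ → Finset (List Bool)
  | 0 => {[]}
  | n + 1 => (lists n).image (List.cons true) ∪ (lists n).image (List.cons false)

lemma mem_lists (n : ℕ) (l : List Bool) : l ∈ lists n ↔ l.length = n := by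
  induction n generalizing l with
  | zero => simp [lists]
  | succ n ih =>
    rcases l with _ | ⟨b, l⟩
    · simp [lists]
    · cases b <;> simp [lists, ih]

lemma sum_lists_succ {M : Type*} [AddCommMonoid M] (n : ℕ) (f : List Bool → M) :
    ∑ l ∈ lists (n + 1), f l = ∑ l ∈ lists n, f (true :: l) + ∑ l ∈ lists n, f (false :: l) := by
  rw [lists, Finset.sum_union, Finset.sum_image, Finset.sum_image]
  · intro a _ b _ h; simpa using h
  · intro a _ b _ h; simpa using h
  · rw [Finset.disjoint_left]; intro a h1 h2
    simp only [Finset.mem_image] at h1 h2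
    obtain ⟨x, _, rfl⟩ := h1
    obtain ⟨y, _, hy⟩ := h2
    simp at hy

lemma single_add_eq (x : Bool × ℤ) (a m : E) :
    Finsupp.single x 1 + a = m ↔ 0 < m x ∧ a = m - Finsupp.single x 1 := by
  constructor
  · rintro rfl
    simp
  · rintro ⟨h, rfl⟩
    have : Finsupp.single x 1 ≤ m := by rw [Finsupp.single_le_iff]; omega
    rw [add_tsub_cancel_of_le this]

lemma W_eq (s r : ℤ) (n : ℕ) (m : E) (v : ℤ) :
    W s r n m v = ∑ l ∈ lists n,
      if edges s r l v = m ∧ endp s r l v = 0 then X ^ (Bst s r l v) else 0 := by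
  induction n generalizing m v with
  | zero => simp [W, lists, edges, endp, Bst, eq_comm]
  | succ n ih =>
    rw [W, sum_lists_succ]
    congr 1
    · split_ifs with h
      · rw [ih, Finset.mul_sum]
        apply Finset.sum_congr rfl
        intro l _
        simp only [edges, endp, Bst, stp, single_add_eq, h, true_and]
        split_ifs with h1
        · rw [pow_add, h1.1]; simp
        · simp
      · symm; apply Finset.sum_eq_zero
        intro l _
        simp only [edges, single_add_eq, h, false_and, if_false]
    · split_ifs with h
      · rw [ih]
        apply Finset.sum_congr rfl
        intro l _
        simp only [edges, endp, Bst, stp, single_add_eq, h, true_and]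
      · symm; apply Finset.sum_eq_zero
        intro l _
        simp only [edges, single_add_eq, h, false_and, if_false]

lemma W_exists (s r : ℤ) (n : ℕ) (m : E) (v : ℤ) (h : W s r n m v ≠ 0) :
    ∃ l, edges s r l v = m ∧ endp s r l v = 0 := by
  rw [W_eq] at h
  obtain ⟨l, _, hl⟩ := Finset.exists_ne_zero_of_sum_ne_zero h
  by_contra hc
  push Not at hc
  apply hl
  rw [if_neg]
  rintro ⟨h1, h2⟩
  exact hc l h1 h2

lemma sg_same (b : Bool) (v w : ℤ) :
    (Finsupp.single (b, v) 1 : E) (b, w) = if w = v then 1 else 0 := by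
  by_cases h : w = v
  · subst h; simp
  · rw [if_neg h, Finsupp.single_apply, if_neg]
    intro h'; simp at h'; exact h h'.symm

lemma sg_tf (v w : ℤ) : (Finsupp.single (true, v) 1 : E) (false, w) = 0 := by simp

lemma sg_ft (v w : ℤ) : (Finsupp.single (false, v) 1 : E) (true, w) = 0 := by simp

lemma sg_ts (v w s : ℤ) :
    (Finsupp.single (true, v) 1 : E) (true, w - s) = if w = v + s then 1 else 0 := by
  rw [sg_same]; exact if_congr (by constructor <;> intro h <;> linarith) rfl rfl

lemma sg_fr (v w r : ℤ) :
    (Finsupp.single (false, v) 1 : E) (false, w + r) = if w = v - r then 1 else 0 := by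
  rw [sg_same]; exact if_congr (by constructor <;> intro h <;> linarith) rfl rfl

/-- demand condition: `m` has flow from `v` to `0`. -/
def Dem (s r : ℤ) (m : E) (v : ℤ) : Prop :=
  ∀ w, m (true, w) + m (false, w) + (if w = 0 then 1 else 0)
    = m (true, w - s) + m (false, w + r) + (if w = v then 1 else 0)

lemma dem_edges (s r : ℤ) (l : List Bool) (v : ℤ) (h : endp s r l v = 0) :
    Dem s r (edges s r l v) v := by
  induction l generalizing v with
  | nil => simp only [endp] at h; subst h; intro w; simp [edges]
  | cons b l ih =>
    intro w
    cases b
    · have hw := ih (v - r) h w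
      simp only [edges, stp, Finsupp.add_apply, sg_ts, sg_fr, sg_tf, sg_ft] at hw ⊢
      simp only [sg_same]
      omega
    · have hw := ih (v + s) h w
      simp only [edges, stp, Finsupp.add_apply, sg_ts, sg_fr, sg_tf, sg_ft] at hw ⊢
      simp only [sg_same]
      omega

noncomputable def P (Vs : Finset ℤ) (m : E) : ℤ[X] := ∏ w ∈ Vs, qb (m (true, w)) (m (false, w))

def ex (Vs : Finset ℤ) (m1 m2 : E) : ℕ := ∑ w ∈ Vs, m1 (true, w) * m2 (false, w)

noncomputable def deg (m : E) : ℕ := m.sum fun _ k => k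

lemma deg_add (a b : E) : deg (a + b) = deg a + deg b := by
  unfold deg; exact Finsupp.sum_add_index' (by simp) (by simp)

lemma deg_single (x : Bool × ℤ) : deg (Finsupp.single x 1) = 1 := by
  unfold deg; simp

lemma deg_zero : deg 0 = 0 := by simp [deg]

lemma deg_eq_zero (m : E) (h : deg m = 0) : m = 0 := by
  unfold deg Finsupp.sum at h
  ext x
  by_contra hx
  have := (Finset.sum_eq_zero_iff.mp h) x (by simpa using hx)
  exact hx (by simpa using this)

lemma sub_single_add (m : E) (x : Bool × ℤ) (h : 0 < m x) :
    m - Finsupp.single x 1 + Finsupp.single x 1 = m := by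
  have : Finsupp.single x 1 ≤ m := by rw [Finsupp.single_le_iff]; omega
  exact tsub_add_cancel_of_le this

lemma anti_shift {M : Type*} [AddCommMonoid M] (m : E) (x : Bool × ℤ) (Φ : E → E → M) :
    ∑ p ∈ Finset.HasAntidiagonal.antidiagonal m, (if 0 < p.1 x then Φ (p.1 - Finsupp.single x 1) p.2 else 0)
      = if 0 < m x then ∑ p ∈ Finset.HasAntidiagonal.antidiagonal (m - Finsupp.single x 1), Φ p.1 p.2 else 0 := by
  rw [← Finset.sum_filter]
  split_ifs with h
  · refine Finset.sum_bij' (fun p _ => (p.1 - Finsupp.single x 1, p.2))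
      (fun p _ => (p.1 + Finsupp.single x 1, p.2)) ?_ ?_ ?_ ?_ ?_
    · rintro ⟨a, b⟩ hp
      simp only [Finset.mem_filter, Finset.HasAntidiagonal.mem_antidiagonal] at hp ⊢
      obtain ⟨rfl, h2⟩ := hp
      have := sub_single_add a x h2
      set a' := a - Finsupp.single x 1
      rw [← this, add_right_comm]; simp
    · rintro ⟨a, b⟩ hp
      simp only [Finset.mem_filter, Finset.HasAntidiagonal.mem_antidiagonal] at hp ⊢
      constructor
      · rw [add_right_comm, hp, sub_single_add m x h]
      · simp
    · rintro ⟨a, b⟩ hp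
      simp only [Finset.mem_filter, Finset.HasAntidiagonal.mem_antidiagonal] at hp ⊢
      rw [sub_single_add a x hp.2]
    · rintro ⟨a, b⟩ hp
      simp
    · rintro ⟨a, b⟩ hp
      rfl
  · apply Finset.sum_eq_zero
    rintro ⟨a, b⟩ hp
    simp only [Finset.mem_filter, Finset.HasAntidiagonal.mem_antidiagonal] at hp
    obtain ⟨rfl, h2⟩ := hp
    simp at h h2; omega

lemma W_succ (s r : ℤ) (m : E) (v : ℤ) (hm : m ≠ 0) :
    W s r (deg m) m v =
    (if 0 < m (true, v) then X ^ (m (false, v)) *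
      W s r (deg (m - Finsupp.single (true, v) 1)) (m - Finsupp.single (true, v) 1) (v + s) else 0) +
    (if 0 < m (false, v) then
      W s r (deg (m - Finsupp.single (false, v) 1)) (m - Finsupp.single (false, v) 1) (v - r)
      else 0) := by
  have key : ∀ x, 0 < m x → deg m = deg (m - Finsupp.single x 1) + 1 := by
    intro x hx
    conv_lhs => rw [← sub_single_add m x hx]
    rw [deg_add, deg_single]
  obtain ⟨n, hn⟩ : ∃ n, deg m = n + 1 := by
    refine Nat.exists_eq_succ_of_ne_zero fun h => hm (deg_eq_zero m h)
  rw [hn, W]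
  congr 1
  · split_ifs with h
    · have := key _ h
      rw [hn] at this
      rw [Nat.succ_injective this]
    · rfl
  · split_ifs with h
    · have := key _ h
      rw [hn] at this
      rw [Nat.succ_injective this]
    · rfl

lemma P_sub_true (Vs : Finset ℤ) (m : E) (v : ℤ) (hv : v ∈ Vs) :
    P Vs (m - Finsupp.single (true, v) 1) = qb (m (true, v) - 1) (m (false, v)) *
      ∏ w ∈ Vs.erase v, qb (m (true, w)) (m (false, w)) := by
  unfold P
  rw [← Finset.mul_prod_erase _ _ hv]
  congr 1
  · simp
  · apply Finset.prod_congr rfl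
    intro w hw
    have : v ≠ w := (Finset.ne_of_mem_erase hw).symm
    simp [Finsupp.single_apply, this]

lemma P_sub_false (Vs : Finset ℤ) (m : E) (v : ℤ) (hv : v ∈ Vs) :
    P Vs (m - Finsupp.single (false, v) 1) = qb (m (true, v)) (m (false, v) - 1) *
      ∏ w ∈ Vs.erase v, qb (m (true, w)) (m (false, w)) := by
  unfold P
  rw [← Finset.mul_prod_erase _ _ hv]
  congr 1
  · simp
  · apply Finset.prod_congr rfl
    intro w hw
    have : v ≠ w := (Finset.ne_of_mem_erase hw).symm
    simp [Finsupp.single_apply, this]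

lemma P_pascal (Vs : Finset ℤ) (m : E) (v : ℤ) (hv : v ∈ Vs)
    (h : 0 < m (true, v) + m (false, v)) :
    P Vs m = (if 0 < m (true, v) then
        X ^ (m (false, v)) * P Vs (m - Finsupp.single (true, v) 1) else 0)
      + (if 0 < m (false, v) then P Vs (m - Finsupp.single (false, v) 1) else 0) := by
  rw [P_sub_true _ _ _ hv, P_sub_false _ _ _ hv]
  conv_lhs => unfold P
  rw [← Finset.mul_prod_erase _ _ hv, qb_pascal _ _ h]
  split_ifs <;> ring

lemma ex_sub_true (Vs : Finset ℤ) (a b : E) (v : ℤ) (hv : v ∈ Vs) (h : 0 < a (true, v)) :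
    ex Vs a b = ex Vs (a - Finsupp.single (true, v) 1) b + b (false, v) := by
  conv_lhs => rw [← sub_single_add a _ h]
  set c := a - Finsupp.single (true, v) 1
  unfold ex
  simp only [Finsupp.add_apply, add_mul, Finset.sum_add_distrib, Finsupp.single_apply,
    Prod.mk.injEq, true_and, ite_mul, one_mul, zero_mul]
  rw [Finset.sum_ite_eq, if_pos hv]

lemma ex_sub_false (Vs : Finset ℤ) (a b : E) (v : ℤ) :
    ex Vs a b = ex Vs (a - Finsupp.single (false, v) 1) b := by
  unfold ex
  simp [Finsupp.single_apply]

lemma dem_sub_true (s r : ℤ) (m : E) (v : ℤ) (hd : Dem s r m v) (h : 0 < m (true, v)) :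
    Dem s r (m - Finsupp.single (true, v) 1) (v + s) := by
  have e1 := sub_single_add m _ h
  set c := m - Finsupp.single (true, v) 1
  intro w
  have hw := hd w
  rw [← e1] at hw
  simp only [Finsupp.add_apply, sg_ts, sg_fr, sg_tf, sg_ft] at hw ⊢
  simp only [sg_same] at hw
  omega

lemma dem_sub_false (s r : ℤ) (m : E) (v : ℤ) (hd : Dem s r m v) (h : 0 < m (false, v)) :
    Dem s r (m - Finsupp.single (false, v) 1) (v - r) := by
  have e1 := sub_single_add m _ h
  set c := m - Finsupp.single (false, v) 1
  intro w
  have hw := hd w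
  rw [← e1] at hw
  simp only [Finsupp.add_apply, sg_ts, sg_fr, sg_tf, sg_ft] at hw ⊢
  simp only [sg_same] at hw
  omega

def Av (m : E) : Prop := m (true, 0) = 0 ∧ m (false, 0) = 0

instance (m : E) : Decidable (Av m) := by unfold Av; infer_instance

theorem PQ (s r : ℤ) (Vs : Finset ℤ) (n : ℕ) (m : E) (v : ℤ) (hn : deg m = n)
    (hd : Dem s r m v) (hs : ∀ x, m x ≠ 0 → x.2 ∈ Vs) :
    P Vs m = ∑ p ∈ Finset.HasAntidiagonal.antidiagonal m,
      if Av p.2 then X ^ (ex Vs p.1 p.2) * W s r (deg p.1) p.1 v * P Vs p.2 else 0 := by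
  induction n generalizing m v with
  | zero =>
    have h0 := deg_eq_zero m hn
    subst h0
    have hv : v = 0 := by
      have := hd 0
      simp at this
      exact this.symm
    subst hv
    simp [Av, ex, W, deg_zero]
  | succ n ih =>
    by_cases hz : v = 0 ∧ Av m
    · obtain ⟨rfl, hz⟩ := hz
      rw [Finset.sum_eq_single (0, m)]
      · simp [hz, ex, W, deg_zero]
      · rintro ⟨a, b⟩ hp hne
        simp only [Finset.HasAntidiagonal.mem_antidiagonal] at hp
        subst hp
        have ha : a ≠ 0 := by rintro rfl; simp at hne
        obtain ⟨h1, h2⟩ := hz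
        simp only [Finsupp.add_apply] at h1 h2
        have g1 : a (true, 0) = 0 := by omega
        have g2 : a (false, 0) = 0 := by omega
        simp [W_succ _ _ _ _ ha, g1, g2]
      · simp
    · have hpos : 0 < m (true, v) + m (false, v) := by
        by_cases hv : v = 0
        · subst hv
          simp only [true_and, Av] at hz
          omega
        · have := hd v
          simp [hv] at this
          omega
      have hvV : v ∈ Vs := by
        rcases (by omega : 0 < m (true, v) ∨ 0 < m (false, v)) with h | h
        · exact hs (true, v) (by omega)
        · exact hs (false, v) (by omega)
      have hsub : ∀ y x, (m - Finsupp.single y 1 : E) x ≠ 0 → x.2 ∈ Vs := by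
        intro y x hx
        apply hs
        simp only [Finsupp.tsub_apply] at hx
        omega
      have hdeg : ∀ x, 0 < m x → deg (m - Finsupp.single x 1) = n := by
        intro x hx
        have := congrArg deg (sub_single_add m x hx)
        rw [deg_add, deg_single, hn] at this
        omega
      rw [P_pascal Vs m v hvV hpos]
      have hterm : ∀ p ∈ Finset.HasAntidiagonal.antidiagonal m,
          (if Av p.2 then X ^ (ex Vs p.1 p.2) * W s r (deg p.1) p.1 v * P Vs p.2 else 0)
          = (if 0 < p.1 (true, v) then (fun a b : E => X ^ (m (false, v)) *
              (if Av b then X ^ (ex Vs a b) * W s r (deg a) a (v + s) * P Vs b else 0))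
              (p.1 - Finsupp.single (true, v) 1) p.2 else 0)
           + (if 0 < p.1 (false, v) then (fun a b : E =>
              (if Av b then X ^ (ex Vs a b) * W s r (deg a) a (v - r) * P Vs b else 0))
              (p.1 - Finsupp.single (false, v) 1) p.2 else 0) := by
        rintro ⟨a, b⟩ hp
        simp only [Finset.HasAntidiagonal.mem_antidiagonal] at hp
        by_cases hA : Av b
        · simp only [hA, if_true]
          by_cases ha : a = 0
          · subst ha
            simp only [zero_add] at hp
            subst hp
            have hv : v ≠ 0 := fun h => hz ⟨h, hA⟩
            simp [W, deg_zero, hv]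
          · rw [W_succ _ _ _ _ ha, mul_add, add_mul]
            congr 1
            · split_ifs with h
              · rw [ex_sub_true Vs a b v hvV h, ← hp, Finsupp.add_apply]
                ring
              · ring
            · split_ifs with h
              · rw [ex_sub_false Vs a b v]
              · ring
        · simp [hA]
      rw [Finset.sum_congr rfl hterm, Finset.sum_add_distrib,
        anti_shift m (true, v) (fun a b : E => X ^ (m (false, v)) *
              (if Av b then X ^ (ex Vs a b) * W s r (deg a) a (v + s) * P Vs b else 0)),
        anti_shift m (false, v) (fun a b : E =>
              (if Av b then X ^ (ex Vs a b) * W s r (deg a) a (v - r) * P Vs b else 0))]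
      congr 1
      · split_ifs with h
        · rw [ih _ _ (hdeg _ h) (dem_sub_true s r m v hd h) (hsub _), Finset.mul_sum]
        · rfl
      · split_ifs with h
        · rw [ih _ _ (hdeg _ h) (dem_sub_false s r m v hd h) (hsub _)]
        · rfl

end LW

namespace LW

open Polynomial

def sg (s r : ℤ) : Bool × ℤ ≃ Bool × ℤ where
  toFun x := match x with
    | (true, v) => (false, v + s)
    | (false, v) => (true, v - r)
  invFun x := match x with
    | (true, v) => (false, v + r)
    | (false, v) => (true, v - s)
  left_inv := by rintro ⟨_ | _, v⟩ <;> simp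
  right_inv := by rintro ⟨_ | _, v⟩ <;> simp

noncomputable def sw (s r : ℤ) (m : E) : E := Finsupp.equivMapDomain (sg s r) m

lemma sw_true (s r : ℤ) (m : E) (w : ℤ) : sw s r m (true, w) = m (false, w + r) := rfl

lemma sw_false (s r : ℤ) (m : E) (w : ℤ) : sw s r m (false, w) = m (true, w - s) := rfl

lemma sw_add (s r : ℤ) (a b : E) : sw s r (a + b) = sw s r a + sw s r b := by
  ext x; simp [sw]

lemma sw_zero (s r : ℤ) : sw s r 0 = 0 := by ext x; simp [sw]

lemma sw_single_true (s r v : ℤ) :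
    sw s r (Finsupp.single (true, v) 1) = Finsupp.single (false, v + s) 1 := by
  unfold sw; rw [Finsupp.equivMapDomain_single]; rfl

lemma sw_single_false (s r v : ℤ) :
    sw s r (Finsupp.single (false, v) 1) = Finsupp.single (true, v - r) 1 := by
  unfold sw; rw [Finsupp.equivMapDomain_single]; rfl

lemma sw_sw (s r : ℤ) (m : E) : sw r s (sw s r m) = m := by
  ext ⟨_ | _, w⟩
  · rw [sw_false, sw_true]; congr 2; ring
  · rw [sw_true, sw_false]; congr 2; ring

lemma deg_sw (s r : ℤ) (m : E) : deg (sw s r m) = deg m := by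
  unfold deg sw
  rw [Finsupp.equivMapDomain_eq_mapDomain]
  exact Finsupp.sum_mapDomain_index_inj (sg s r).injective

lemma dem_zero_iff (s r : ℤ) (m : E) :
    Dem s r m 0 ↔ ∀ w, m (true, w) + m (false, w) = m (true, w - s) + m (false, w + r) := by
  unfold Dem
  exact forall_congr' fun w => by omega

lemma dem_sw (s r : ℤ) (m : E) : Dem r s (sw s r m) 0 ↔ Dem s r m 0 := by
  rw [dem_zero_iff, dem_zero_iff]
  refine forall_congr' fun w => ?_
  simp only [sw_true, sw_false, sub_add_cancel, add_sub_cancel_right]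
  omega

lemma dem_of_add (s r : ℤ) (a b : E) (h : Dem s r (a + b) 0) (ha : Dem s r a 0) :
    Dem s r b 0 := by
  rw [dem_zero_iff] at *
  intro w
  have h1 := h w
  have h2 := ha w
  simp only [Finsupp.add_apply] at h1
  omega

lemma av_sw (s r : ℤ) (m : E) (h : Dem s r m 0) : Av (sw s r m) ↔ Av m := by
  rw [dem_zero_iff] at h
  have := h 0
  unfold Av
  rw [sw_true, sw_false]
  omega

def Sup (Vs : Finset ℤ) (m : E) : Prop := ∀ x, m x ≠ 0 → x.2 ∈ Vs

lemma prod_shift (Vs : Finset ℤ) (f : ℤ → ℕ) (c : ℤ) (h1 : ∀ w, f w ≠ 0 → w ∈ Vs)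
    (h2 : ∀ w, f (w + c) ≠ 0 → w ∈ Vs) :
    ∏ w ∈ Vs, qf (f w) = ∏ w ∈ Vs, qf (f (w + c)) := by
  rw [← finprod_eq_prod_of_mulSupport_subset (fun w => qf (f w)),
    ← finprod_eq_prod_of_mulSupport_subset (fun w => qf (f (w + c)))]
  · exact (finprod_comp_equiv (Equiv.addRight c) (f := fun w => qf (f w))).symm
  · intro w hw
    apply h2
    intro h; apply hw; simp [h, qf_zero]
  · intro w hw
    apply h1
    intro h; apply hw; simp [h, qf_zero]

lemma P_fact (Vs : Finset ℤ) (m : E) :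
    P Vs m * ((∏ w ∈ Vs, qf (m (true, w))) * ∏ w ∈ Vs, qf (m (false, w)))
      = ∏ w ∈ Vs, qf (m (true, w) + m (false, w)) := by
  unfold P
  rw [← Finset.prod_mul_distrib, ← Finset.prod_mul_distrib]
  exact Finset.prod_congr rfl fun w _ => qb_fact _ _

lemma P_sw (s r : ℤ) (Vs : Finset ℤ) (m : E) (hm : Dem s r m 0) (h1 : Sup Vs m)
    (h2 : Sup Vs (sw s r m)) : P Vs (sw s r m) = P Vs m := by
  have e1 := P_fact Vs m
  have e2 := P_fact Vs (sw s r m)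
  have f1 := prod_shift Vs (fun w => m (true, w)) (-s) (fun w h => h1 (true, w) h)
    (fun w h => h2 (false, w) (by rw [sw_false, sub_eq_add_neg]; exact h))
  have f2 := prod_shift Vs (fun w => m (false, w)) r (fun w h => h1 (false, w) h)
    (fun w h => h2 (true, w) (by rw [sw_true]; exact h))
  simp only [sw_true, sw_false, sub_eq_add_neg] at e2

  rw [← f1, ← f2] at e2
  have e3 : ∏ w ∈ Vs, qf (m (false, w + r) + m (true, w + -s))
      = ∏ w ∈ Vs, qf (m (true, w) + m (false, w)) := by
    apply Finset.prod_congr rfl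
    intro w _
    rw [dem_zero_iff] at hm
    rw [hm w, add_comm, sub_eq_add_neg]
  rw [e3, ← e1, mul_comm (∏ w ∈ Vs, qf (m (false, w)))] at e2
  refine mul_right_cancel₀ ?_ e2
  exact mul_ne_zero (Finset.prod_ne_zero_iff.mpr fun _ _ => qf_ne _)
    (Finset.prod_ne_zero_iff.mpr fun _ _ => qf_ne _)

lemma exists_pot (s r : ℤ) (hr : 0 < r) (Vs : Finset ℤ) (m : E) (hm : Dem s r m 0) (h1 : Sup Vs m) :
    ∃ H : ℤ → ℤ, (∀ v, H (v + s) = H v + m (false, v)) ∧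
      ∀ v, H (v - r) = H v - m (true, v - r - s) := by
  rw [dem_zero_iff] at hm
  let G : ℤ → ℤ := fun v => ∑ u ∈ Vs, if u ≤ v ∧ r ∣ v - u then (m (true, u) : ℤ) else 0
  have hG : ∀ v, G v - G (v - r) = m (true, v) := by
    intro v
    simp only [G]
    rw [← Finset.sum_sub_distrib]
    have : ∀ u ∈ Vs, ((if u ≤ v ∧ r ∣ v - u then (m (true, u) : ℤ) else 0) -
        if u ≤ v - r ∧ r ∣ v - r - u then (m (true, u) : ℤ) else 0)
        = if v = u then (m (true, u) : ℤ) else 0 := by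
      intro u _
      have hd : r ∣ v - r - u ↔ r ∣ v - u := by
        rw [show v - r - u = (v - u) - r by ring]; exact dvd_sub_self_right
      simp only [hd]
      by_cases hvu : v = u
      · subst hvu
        simp [hr]
      · rw [if_neg hvu]
        by_cases hdv : r ∣ v - u
        · have : u ≤ v ↔ u ≤ v - r := by
            constructor
            · intro h
              have : r ≤ v - u := Int.le_of_dvd (by omega) hdv
              omega
            · intro h; omega
          simp [this]
        · simp [hdv]
    rw [Finset.sum_congr rfl this, Finset.sum_ite_eq]
    split_ifs with h
    · rfl
    · by_contra hne
      exact h (h1 (true, v) (by simpa using Ne.symm hne))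
  -- far down
  obtain ⟨L, hL⟩ : ∃ L : ℤ, ∀ u ∈ Vs, L < u := by
    obtain ⟨L, hL⟩ := Vs.bddBelow
    exact ⟨L - 1, fun u hu => by have := hL hu; omega⟩
  have hG0 : ∀ v, v ≤ L → G v = 0 := by
    intro v hv
    apply Finset.sum_eq_zero
    intro u hu
    rw [if_neg]
    intro h
    have := hL u hu
    omega
  have hf0 : ∀ v, v ≤ L → m (false, v) = 0 := by
    intro v hv
    by_contra hne
    have := hL _ (h1 (false, v) hne)
    simp at this; omega
  let D : ℤ → ℤ := fun v => G v - G (v - s) - m (false, v + r)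
  have hD : ∀ v, D v = D (v - r) := by
    intro v
    have a1 := hG v
    have a2 := hG (v - s)
    have a3 := hm v
    simp only [D]
    rw [show v - r - s = v - s - r by ring, sub_add_cancel]
    push_cast [← @Nat.cast_inj ℤ] at a3
    linarith
  have hDn : ∀ (k : ℕ) v, D v = D (v - k * r) := by
    intro k
    induction k with
    | zero => intro v; simp
    | succ k ih => intro v; rw [ih v, hD]; congr 1; push_cast; ring
  have hD0 : ∀ v, D v = 0 := by
    intro v
    rw [hDn (|v| + |L| + |s| + |r|).toNat v]
    have hk : ((|v| + |L| + |s| + |r|).toNat : ℤ) = |v| + |L| + |s| + |r| :=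
      Int.toNat_of_nonneg (by positivity)
    rw [hk]
    have hb : v - (|v| + |L| + |s| + |r|) * r ≤ v - (|v| + |L| + |s| + |r|) := by
      have : (|v| + |L| + |s| + |r|) * 1 ≤ (|v| + |L| + |s| + |r|) * r :=
        mul_le_mul_of_nonneg_left (by omega) (by positivity)
      linarith
    generalize v - (|v| + |L| + |s| + |r|) * r = z at hb
    have c1 := le_abs_self v
    have c2 := neg_abs_le L
    have c3 := neg_abs_le s
    have c4 := le_abs_self r
    have c5 := abs_nonneg L
    have c6 := abs_nonneg s
    simp only [D]
    rw [hG0 z (by omega), hG0 (z - s) (by omega), hf0 (z + r) (by omega)]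
    simp
  refine ⟨fun v => G (v - r - s), fun v => ?_, fun v => ?_⟩
  · have := hD0 (v - r)
    simp only [D, sub_add_cancel] at this
    simp only
    rw [show v + s - r - s = v - r by ring]
    linarith
  · have := hG (v - r - s)
    simp only
    rw [show v - r - r - s = v - r - s - r by ring]
    linarith

lemma ex_add (Vs : Finset ℤ) (a b c : E) : ex Vs (a + b) c = ex Vs a c + ex Vs b c := by
  simp [ex, add_mul, Finset.sum_add_distrib]

lemma ex_single_true (Vs : Finset ℤ) (v : ℤ) (c : E) (h : Sup Vs c) :
    ex Vs (Finsupp.single (true, v) 1) c = c (false, v) := by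
  unfold ex
  simp only [sg_same, ite_mul, one_mul, zero_mul]
  rw [Finset.sum_ite_eq']
  split_ifs with hv
  · rfl
  · by_contra hne
    exact hv (h (false, v) (Ne.symm hne))

lemma ex_single_false (Vs : Finset ℤ) (v : ℤ) (c : E) :
    ex Vs (Finsupp.single (false, v) 1) c = 0 := by
  unfold ex
  simp [sg_ft]

lemma ex_trail (s r : ℤ) (Vs : Finset ℤ) (m : E) (h1 : Sup Vs m)
    (h2 : Sup Vs (sw s r m)) (H : ℤ → ℤ) (hU : ∀ v, H (v + s) = H v + m (false, v))
    (hD : ∀ v, H (v - r) = H v - m (true, v - r - s)) (l : List Bool) (v : ℤ) :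
    (ex Vs (edges s r l v) m : ℤ) - ex Vs (sw s r (edges s r l v)) (sw s r m)
      = H (endp s r l v) - H v := by
  induction l generalizing v with
  | nil => simp [edges, endp, ex, sw_zero]
  | cons b l ih =>
    cases b
    · have := ih (v - r)
      simp only [edges, endp, stp, sw_add, ex_add, sw_single_false]
      rw [ex_single_true _ _ _ h2, ex_single_false, sw_false]
      rw [hD] at this
      push_cast
      linarith
    · have := ih (v + s)
      simp only [edges, endp, stp, sw_add, ex_add, sw_single_true]
      rw [ex_single_true _ _ _ h1, ex_single_false]
      rw [hU] at this
      push_cast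
      linarith

lemma Sup_add_left (Vs : Finset ℤ) (a b : E) (h : Sup Vs (a + b)) : Sup Vs a := by
  intro x hx
  exact h x (by simp only [Finsupp.add_apply]; omega)

lemma Sup_add_right (Vs : Finset ℤ) (a b : E) (h : Sup Vs (a + b)) : Sup Vs b := by
  intro x hx
  exact h x (by simp only [Finsupp.add_apply]; omega)

theorem W_sw (s r : ℤ) (hr : 0 < r) (n : ℕ) (m : E) (hn : deg m = n) (hm : Dem s r m 0) :
    W s r (deg m) m 0 = W r s (deg m) (sw s r m) 0 := by
  induction n using Nat.strong_induction_on generalizing m with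
  | _ n ih =>
  obtain ⟨Vs, hV1, hV2⟩ : ∃ Vs : Finset ℤ, Sup Vs m ∧ Sup Vs (sw s r m) := by
    refine ⟨m.support.image Prod.snd ∪ (sw s r m).support.image Prod.snd, ?_, ?_⟩
    · intro x hx
      exact Finset.mem_union_left _ (Finset.mem_image_of_mem _ (by simpa using hx))
    · intro x hx
      exact Finset.mem_union_right _ (Finset.mem_image_of_mem _ (by simpa using hx))
  have e1 := PQ s r Vs n m 0 hn hm hV1
  have e2 := PQ r s Vs n (sw s r m) 0 (by rw [deg_sw, hn]) ((dem_sw s r m).mpr hm) hV2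
  have e3 : ∑ p ∈ Finset.HasAntidiagonal.antidiagonal (sw s r m),
      (if Av p.2 then X ^ (ex Vs p.1 p.2) * W r s (deg p.1) p.1 0 * P Vs p.2 else 0)
      = ∑ p ∈ Finset.HasAntidiagonal.antidiagonal m,
      if Av (sw s r p.2) then X ^ (ex Vs (sw s r p.1) (sw s r p.2)) *
        W r s (deg p.1) (sw s r p.1) 0 * P Vs (sw s r p.2) else 0 := by
    symm
    refine Finset.sum_bij' (fun p _ => (sw s r p.1, sw s r p.2))
      (fun p _ => (sw r s p.1, sw r s p.2)) ?_ ?_ ?_ ?_ ?_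
    · rintro ⟨a, b⟩ hp
      simp only [Finset.HasAntidiagonal.mem_antidiagonal] at hp ⊢
      rw [← sw_add, hp]
    · rintro ⟨a, b⟩ hp
      simp only [Finset.HasAntidiagonal.mem_antidiagonal] at hp ⊢
      rw [← sw_add, hp, sw_sw]
    · rintro ⟨a, b⟩ hp
      simp only [sw_sw]
    · rintro ⟨a, b⟩ hp
      simp only [sw_sw]
    · rintro ⟨a, b⟩ hp
      simp only [deg_sw]
  rw [P_sw s r Vs m hm hV1 hV2, e3] at e2
  have e4 := e1.symm.trans e2
  have hmem : (m, (0 : E)) ∈ Finset.HasAntidiagonal.antidiagonal m := by simp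
  rw [← Finset.add_sum_erase _ _ hmem, ← Finset.add_sum_erase _ _ hmem] at e4
  have e5 : ∀ p ∈ (Finset.HasAntidiagonal.antidiagonal m).erase (m, 0),
      (if Av p.2 then X ^ (ex Vs p.1 p.2) * W s r (deg p.1) p.1 0 * P Vs p.2 else 0)
      = if Av (sw s r p.2) then X ^ (ex Vs (sw s r p.1) (sw s r p.2)) *
        W r s (deg p.1) (sw s r p.1) 0 * P Vs (sw s r p.2) else 0 := by
    rintro ⟨a, b⟩ hp
    rw [Finset.mem_erase] at hp
    obtain ⟨hne, hp⟩ := hp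
    simp only [Finset.HasAntidiagonal.mem_antidiagonal] at hp
    subst hp
    by_cases hda : Dem s r a 0
    · have hdb := dem_of_add s r a b hm hda
      have hb : b ≠ 0 := by rintro rfl; simp at hne
      have hlt : deg a < n := by
        rw [deg_add] at hn
        have : deg b ≠ 0 := fun h => hb (deg_eq_zero b h)
        omega
      have hW := ih (deg a) hlt a rfl hda
      have hVb1 := Sup_add_right _ _ _ hV1
      rw [sw_add] at hV2
      have hVb2 := Sup_add_right _ _ _ hV2
      simp only [av_sw s r b hdb, P_sw s r Vs b hdb hVb1 hVb2, ← hW]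
      by_cases hW0 : W s r (deg a) a 0 = 0
      · simp [hW0]
      · obtain ⟨l, hl1, hl2⟩ := W_exists _ _ _ _ _ hW0
        obtain ⟨H, hU, hD⟩ := exists_pot s r hr Vs b hdb hVb1
        have := ex_trail s r Vs b hVb1 hVb2 H hU hD l 0
        rw [hl1, hl2, sub_self, sub_eq_zero, Nat.cast_inj] at this
        rw [this]
    · have w1 : W s r (deg a) a 0 = 0 := by
        by_contra h
        obtain ⟨l, hl1, hl2⟩ := W_exists _ _ _ _ _ h
        exact hda (hl1 ▸ dem_edges s r l 0 hl2)
      have w2 : W r s (deg a) (sw s r a) 0 = 0 := by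
        by_contra h
        obtain ⟨l, hl1, hl2⟩ := W_exists _ _ _ _ _ h
        exact hda ((dem_sw s r a).mp (hl1 ▸ dem_edges r s l 0 hl2))
      simp [w1, w2]
  rw [Finset.sum_congr rfl e5, add_left_inj] at e4
  simpa [Av, sw_zero, ex, P, qb_zero_left] using e4

end LW

namespace LW

open Polynomial

def cnt (f : ℕ → ℕ → ℕ) : ℕ → ℕ → List Bool → ℕ
  | _, _, [] => 0
  | a, b, true :: l => cnt f (a + 1) b l
  | a, b, false :: l => f a b + cnt f a (b + 1) l

def stat (f : ℕ → ℕ → ℕ) : List Bool → ℕ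
  | [] => 0
  | true :: l => cnt f 0 0 l + stat f l
  | false :: l => stat f l

def cntR (f : ℕ → ℕ → ℕ) (a b : ℕ) : List Bool → ℕ
  | [] => 0
  | true :: l => f (a + l.count true) (b + l.count false) + cntR f a b l
  | false :: l => cntR f a b l

lemma cnt_add (f g : ℕ → ℕ → ℕ) (a b : ℕ) (l : List Bool) :
    cnt (fun a b => f a b + g a b) a b l = cnt f a b l + cnt g a b l := by
  induction l generalizing a b with
  | nil => rfl
  | cons x l ih => cases x <;> simp only [cnt, ih] <;> omega

lemma stat_add (f g : ℕ → ℕ → ℕ) (l : List Bool) :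
    stat (fun a b => f a b + g a b) l = stat f l + stat g l := by
  induction l with
  | nil => rfl
  | cons x l ih => cases x <;> simp only [stat, ih, cnt_add] <;> omega

lemma cntR_snoc_true (f : ℕ → ℕ → ℕ) (a b : ℕ) (l : List Bool) :
    cntR f a b (l ++ [true]) = cntR f (a + 1) b l + f a b := by
  induction l with
  | nil => simp [cntR]
  | cons x l ih =>
    cases x
    · simp [cntR, ih]
    · simp only [List.cons_append, cntR, ih, List.count_append]
      simp [add_assoc, add_comm 1]

lemma cntR_snoc_false (f : ℕ → ℕ → ℕ) (a b : ℕ) (l : List Bool) :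
    cntR f a b (l ++ [false]) = cntR f a (b + 1) l := by
  induction l with
  | nil => simp [cntR]
  | cons x l ih =>
    cases x
    · simp [cntR, ih]
    · simp only [List.cons_append, cntR, ih, List.count_append]
      simp [add_assoc, add_comm 1]

lemma cnt_snoc_true (f : ℕ → ℕ → ℕ) (a b : ℕ) (l : List Bool) :
    cnt f a b (l ++ [true]) = cnt f a b l := by
  induction l generalizing a b with
  | nil => simp [cnt]
  | cons x l ih => cases x <;> simp [cnt, ih]

lemma cnt_snoc_false (f : ℕ → ℕ → ℕ) (a b : ℕ) (l : List Bool) :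
    cnt f a b (l ++ [false]) = cnt f a b l + f (a + l.count true) (b + l.count false) := by
  induction l generalizing a b with
  | nil => simp [cnt]
  | cons x l ih => cases x <;> simp [cnt, ih, add_assoc, add_comm 1]

lemma stat_snoc_true (f : ℕ → ℕ → ℕ) (l : List Bool) :
    stat f (l ++ [true]) = stat f l := by
  induction l with
  | nil => simp [stat, cnt]
  | cons x l ih => cases x <;> simp [stat, ih, cnt_snoc_true]

lemma stat_snoc_false (f : ℕ → ℕ → ℕ) (l : List Bool) :
    stat f (l ++ [false]) = stat f l + cntR f 0 0 l := by
  induction l with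
  | nil => simp [stat, cntR]
  | cons x l ih =>
    cases x
    · simp [stat, ih, cntR]
    · simp [stat, ih, cnt_snoc_false, cntR]; omega

def rs : List Bool → List Bool
  | [] => []
  | b :: l => rs l ++ [!b]

lemma rs_snoc (l : List Bool) (b : Bool) : rs (l ++ [b]) = (!b) :: rs l := by
  induction l with
  | nil => rfl
  | cons x l ih => simp [rs, ih]

lemma rs_rs (l : List Bool) : rs (rs l) = l := by
  induction l with
  | nil => rfl
  | cons x l ih => simp [rs, rs_snoc, ih]

lemma rs_length (l : List Bool) : (rs l).length = l.length := by
  induction l with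
  | nil => rfl
  | cons x l ih => simp [rs, ih]

lemma cntR_rs (f : ℕ → ℕ → ℕ) (a b : ℕ) (l : List Bool) :
    cntR f a b (rs l) = cnt (fun x y => f y x) b a l := by
  induction l generalizing a b with
  | nil => rfl
  | cons x l ih =>
    cases x
    · simp only [rs, Bool.not_false, cntR_snoc_true, ih, cnt]; omega
    · simp only [rs, Bool.not_true, cntR_snoc_false, ih, cnt]

lemma stat_rs (f : ℕ → ℕ → ℕ) (l : List Bool) :
    stat f (rs l) = stat (fun x y => f y x) l := by
  induction l with
  | nil => rfl
  | cons x l ih =>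
    cases x
    · simp only [rs, Bool.not_false, stat_snoc_true, ih, stat]
    · simp only [rs, Bool.not_true, stat_snoc_false, ih, stat, cntR_rs]; omega

lemma edges_snoc (s r : ℤ) (l : List Bool) (b : Bool) (v : ℤ) :
    edges s r (l ++ [b]) v = edges s r l v + Finsupp.single (b, endp s r l v) 1 := by
  induction l generalizing v with
  | nil => simp [edges, endp]
  | cons x l ih => simp [edges, endp, ih, add_assoc]

lemma endp_snoc (s r : ℤ) (l : List Bool) (b : Bool) (v : ℤ) :
    endp s r (l ++ [b]) v = stp s r b (endp s r l v) := by
  induction l generalizing v with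
  | nil => simp [endp]
  | cons x l ih => simp [endp, ih]

lemma endp_rs (s r : ℤ) (l : List Bool) (v : ℤ) : endp r s (rs l) (endp s r l v) = v := by
  induction l generalizing v with
  | nil => rfl
  | cons x l ih =>
    rw [rs, endp_snoc, endp, ih]
    cases x <;> simp [stp]

lemma edges_rs (s r : ℤ) (l : List Bool) (v : ℤ) :
    edges r s (rs l) (endp s r l v) = sw s r (edges s r l v) := by
  induction l generalizing v with
  | nil => simp [rs, edges, sw_zero]
  | cons x l ih =>
    rw [rs, edges_snoc, endp, ih, edges, sw_add, endp_rs, add_comm]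
    cases x
    · rw [sw_single_false]; rfl
    · rw [sw_single_true]; rfl

lemma endp_count (s r : ℤ) (l : List Bool) (v : ℤ) :
    endp s r l v = v + s * l.count true - r * l.count false := by
  induction l generalizing v with
  | nil => simp [endp]
  | cons x l ih => cases x <;> simp [endp, ih, stp] <;> ring

lemma deg_edges (s r : ℤ) (l : List Bool) (v : ℤ) : deg (edges s r l v) = l.length := by
  induction l generalizing v with
  | nil => simp [edges, deg_zero]
  | cons x l ih => simp [edges, deg_add, deg_single, ih, add_comm]

/-- a statistic depending on `δ`. -/
def fz (s r : ℤ) (F : ℤ → ℕ) (a b : ℕ) : ℕ := F (s * (a + 1) - r * (b + 1))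

lemma edges_cnt (s r : ℤ) (l : List Bool) (p v : ℤ) (a b : ℕ) (h : p - v = s * (a + 1) - r * b) :
    edges s r l p (false, v) = cnt (fz s r fun d => if d = -r then 1 else 0) a b l := by
  induction l generalizing p a b with
  | nil => rfl
  | cons x l ih =>
    cases x
    · simp only [edges, cnt, stp, Finsupp.add_apply, sg_same]
      rw [ih (p - r) a (b + 1) (by push_cast; linarith)]
      congr 1
      unfold fz
      exact if_congr (by constructor <;> intro h <;> linarith) rfl rfl
    · simp only [edges, cnt, stp, Finsupp.add_apply, sg_tf, zero_add]
      rw [ih (p + s) (a + 1) b (by push_cast; linarith)]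

lemma Bst_stat (s r : ℤ) (l : List Bool) (v : ℤ) :
    Bst s r l v = stat (fz s r fun d => if d = -r then 1 else 0) l := by
  induction l generalizing v with
  | nil => rfl
  | cons x l ih =>
    cases x
    · simp only [Bst, stat, ih]
    · simp only [Bst, stat, ih]
      rw [edges_cnt s r l (v + s) v 0 0 (by simp)]

lemma stat_A (s r : ℤ) (l : List Bool) (v : ℤ) :
    stat (fz s r fun d => if d = s then 1 else 0) l = Bst r s (rs l) v := by
  rw [Bst_stat, stat_rs]
  congr 1
  funext a b
  unfold fz
  exact if_congr (by constructor <;> intro h <;> linarith) rfl rfl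

lemma W_coeff (s r : ℤ) (n : ℕ) (m : E) (k : ℕ) :
    (W s r n m 0).coeff k = ((lists n).filter fun l =>
      edges s r l 0 = m ∧ endp s r l 0 = 0 ∧ Bst s r l 0 = k).card := by
  rw [W_eq, finsetSum_coeff, Finset.card_filter, Nat.cast_sum]
  apply Finset.sum_congr rfl
  intro l _
  by_cases h : edges s r l 0 = m ∧ endp s r l 0 = 0
  · rw [if_pos h, coeff_X_pow]
    simp [h.1, h.2, eq_comm]
  · rw [if_neg h, if_neg]
    · simp
    · rintro ⟨h1, h2, _⟩; exact h ⟨h1, h2⟩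

theorem AB (s r : ℤ) (hr : 0 < r) (n : ℕ) (m : E) (k : ℕ) :
    ((lists n).filter fun l => edges s r l 0 = m ∧ endp s r l 0 = 0 ∧
      stat (fz s r fun d => if d = -r then 1 else 0) l = k).card
    = ((lists n).filter fun l => edges s r l 0 = m ∧ endp s r l 0 = 0 ∧
      stat (fz s r fun d => if d = s then 1 else 0) l = k).card := by
  by_cases hne : ∃ l ∈ lists n, edges s r l 0 = m ∧ endp s r l 0 = 0
  · obtain ⟨l, hl, rfl, h2⟩ := hne
    have hd := dem_edges s r l 0 h2
    have hn : deg (edges s r l 0) = n := by rw [deg_edges]; exact (mem_lists n l).mp hl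
    set m := edges s r l 0
    have key := W_sw s r hr n m hn hd
    rw [hn] at key
    have c := congrArg (fun p => p.coeff k) key
    simp only [W_coeff, Nat.cast_inj] at c
    simp only [Bst_stat s r] at c
    rw [c]
    refine Finset.card_bij' (fun l _ => rs l) (fun l _ => rs l) ?_ ?_ ?_ ?_
    · intro l hl
      simp only [Finset.mem_filter, mem_lists] at hl ⊢
      obtain ⟨h0, h1, h2, h3⟩ := hl
      have e1 := edges_rs r s l 0
      have e2 := endp_rs r s l 0
      rw [h2] at e1 e2
      refine ⟨by rw [rs_length, h0], ?_, e2, ?_⟩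
      · rw [e1, h1, sw_sw]
      · rw [stat_A s r _ 0, rs_rs, h3]
    · intro l hl
      simp only [Finset.mem_filter, mem_lists] at hl ⊢
      obtain ⟨h0, h1, h2, h3⟩ := hl
      have e1 := edges_rs s r l 0
      have e2 := endp_rs s r l 0
      rw [h2] at e1 e2
      refine ⟨by rw [rs_length, h0], ?_, e2, ?_⟩
      · rw [e1, h1]
      · rw [← stat_A s r _ 0, h3]
    · intro l _; exact rs_rs l
    · intro l _; exact rs_rs l
  · rw [Finset.filter_false_of_mem, Finset.filter_false_of_mem]
    · intro l hl h; exact hne ⟨l, hl, h.1, h.2.1⟩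
    · intro l hl h; exact hne ⟨l, hl, h.1, h.2.1⟩

/-! Part II -/

def sumU (s r : ℤ) (φ : ℤ → ℤ) : List Bool → ℤ → ℤ
  | [], _ => 0
  | true :: l, v => φ v + sumU s r φ l (v + s)
  | false :: l, v => sumU s r φ l (v - r)

lemma sumU_edges (s r : ℤ) (φ : ℤ → ℤ) (l : List Bool) (v : ℤ) :
    sumU s r φ l v = (edges s r l v).sum fun x k => if x.1 then (k : ℤ) * φ x.2 else 0 := by
  induction l generalizing v with
  | nil => simp [sumU, edges]
  | cons x l ih =>
    rw [edges, Finsupp.sum_add_index', Finsupp.sum_single_index]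
    · cases x <;> simp [sumU, stp, ih]
    · simp
    · simp
    · intro a b c; split_ifs <;> push_cast <;> ring

lemma sumU_add (s r : ℤ) (φ ψ : ℤ → ℤ) (l : List Bool) (v : ℤ) :
    sumU s r (fun u => φ u + ψ u) l v = sumU s r φ l v + sumU s r ψ l v := by
  induction l generalizing v with
  | nil => simp [sumU]
  | cons x l ih => cases x <;> simp only [sumU, ih] <;> ring

lemma cnt_g (s r : ℤ) (g : ℤ → ℤ) (F : ℤ → ℕ) (c : ℤ) (hg : ∀ x, g x - g (x + r) = c * F x)
    (l : List Bool) (u v : ℤ) (a b : ℕ) (h : v - u = s * (a + 1) - r * b) :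
    c * (cnt (fz s r F) a b l : ℕ) = g (endp s r l v - u) - g (v - u)
      - sumU s r (fun p => g (p - u + s) - g (p - u)) l v := by
  induction l generalizing v a b with
  | nil => simp [cnt, endp, sumU]
  | cons x l ih =>
    cases x
    · simp only [cnt, endp, sumU, stp]
      have h1 := ih (v - r) a (b + 1) (by push_cast; linarith)
      have h2 := hg (v - r - u)
      rw [show v - r - u + r = v - u by ring] at h2
      have h3 : fz s r F a b = F (v - r - u) := by
        unfold fz; congr 1; linarith
      rw [h3]
      push_cast
      rw [mul_add, h1, ← h2]
      ring
    · simp only [cnt, endp, sumU, stp]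
      have h1 := ih (v + s) (a + 1) b (by push_cast; linarith)
      rw [h1, show v + s - u = v - u + s by ring]
      ring

lemma stat_g (s r : ℤ) (g : ℤ → ℤ) (F : ℤ → ℕ) (c : ℤ) (hg : ∀ x, g x - g (x + r) = c * F x)
    (hs : ∀ x, g (s - x) = - g x) (l : List Bool) (v : ℤ) :
    2 * c * (stat (fz s r F) l : ℕ) =
      2 * sumU s r (fun u => g (endp s r l v - u) - g s) l v
      - sumU s r (fun u => sumU s r (fun p => g (p - u + s) - g (p - u)) l v) l v
      + sumU s r (fun _ => g s - g 0) l v := by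
  have he : ∀ x, g (-x + s) - g (-x) = g (x + s) - g x := by
    intro x
    have h1 := hs x
    have h2 := hs (x + s)
    rw [show s - (x + s) = - x by ring] at h2
    rw [show s - x = -x + s by ring] at h1
    linarith
  induction l generalizing v with
  | nil => simp [stat, sumU]
  | cons x l ih =>
    cases x
    · simp only [stat, endp, sumU, stp]
      exact ih (v - r)
    · simp only [stat, endp, sumU, stp]
      have h1 := ih (v + s)
      have h2 := cnt_g s r g F c hg l v (v + s) 0 0 (by simp)
      rw [sumU_add s r (fun u => g (v - u + s) - g (v - u))]
      have h3 : sumU s r (fun u => g (v - u + s) - g (v - u)) l (v + s)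
          = sumU s r (fun p => g (p - v + s) - g (p - v)) l (v + s) := by
        congr 1; funext u
        rw [← he (u - v)]
        rw [show -(u - v) = v - u by ring]
      rw [h3]
      push_cast
      rw [add_sub_cancel_left] at h2
      simp only [sub_self, zero_add]
      linear_combination 2 * h2 + h1

lemma stat_congr (s r : ℤ) (g : ℤ → ℤ) (F : ℤ → ℕ) (c : ℤ) (hc : c ≠ 0)
    (hg : ∀ x, g x - g (x + r) = c * F x)
    (hs : ∀ x, g (s - x) = - g x) (l l' : List Bool) (v : ℤ)
    (he : edges s r l v = edges s r l' v) (hp : endp s r l v = endp s r l' v) :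
    stat (fz s r F) l = stat (fz s r F) l' := by
  have key : ∀ φ, sumU s r φ l v = sumU s r φ l' v := by
    intro φ; rw [sumU_edges, sumU_edges, he]
  have h1 := stat_g s r g F c hg hs l v
  have h2 := stat_g s r g F c hg hs l' v
  have : 2 * c * (stat (fz s r F) l : ℕ) = 2 * c * (stat (fz s r F) l' : ℕ) := by
    rw [h1, h2]; simp only [key, hp]
  have h3 := mul_left_cancel₀ (mul_ne_zero two_ne_zero hc) this
  exact_mod_cast h3

lemma stat_one_congr (s r : ℤ) (hr : 0 < r) (l l' : List Bool) (v : ℤ)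
    (he : edges s r l v = edges s r l' v) (hp : endp s r l v = endp s r l' v) :
    stat (fun _ _ => 1) l = stat (fun _ _ => 1) l' :=
  stat_congr s r (fun x => s - 2 * x) (fun _ => 1) (2 * r) (by omega)
    (by intro x; push_cast; ring) (by intro x; ring) l l' v he hp

lemma stat_mid_congr (s r : ℤ) (hr : 0 < r) (l l' : List Bool) (v : ℤ)
    (he : edges s r l v = edges s r l' v) (hp : endp s r l v = endp s r l' v) :
    stat (fz s r fun d => if -r < d ∧ d < s then 1 else 0) l
      = stat (fz s r fun d => if -r < d ∧ d < s then 1 else 0) l' := by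
  refine stat_congr s r (fun x => ∑ y ∈ Finset.Ioo (-r) s,
    if r ∣ y - x then (if x ≤ y then (1 : ℤ) else -1) else 0) _ 2 two_ne_zero ?_ ?_ l l' v he hp
  · intro x
    rw [← Finset.sum_sub_distrib]
    have : ∀ y ∈ Finset.Ioo (-r) s,
        ((if r ∣ y - x then (if x ≤ y then (1 : ℤ) else -1) else 0)
          - if r ∣ y - (x + r) then (if x + r ≤ y then (1 : ℤ) else -1) else 0)
        = if x = y then 2 else 0 := by
      intro y _
      have hd : r ∣ y - (x + r) ↔ r ∣ y - x := by
        rw [show y - (x + r) = (y - x) - r by ring]; exact dvd_sub_self_right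
      simp only [hd]
      by_cases h : r ∣ y - x
      · simp only [h, if_true]
        obtain ⟨t, ht⟩ := h
        by_cases hxy : x = y
        · subst hxy; simp [not_le.mpr hr]
        · have : x ≤ y ↔ x + r ≤ y := by
            constructor
            · intro h
              have : r ≤ y - x := Int.le_of_dvd (by omega) ⟨t, ht⟩
              omega
            · intro h; omega
          simp [this, hxy]
      · simp only [h, if_false]
        rw [if_neg]; · simp
        rintro rfl; simp at h
    rw [Finset.sum_congr rfl this, Finset.sum_ite_eq]; simp only [Finset.mem_Ioo]
    split_ifs <;> simp
  · intro x
    rw [← Finset.sum_neg_distrib]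
    refine Finset.sum_bij' (fun y _ => s - r - y) (fun y _ => s - r - y) ?_ ?_ ?_ ?_ ?_
    · intro y hy; simp only [Finset.mem_Ioo] at hy ⊢; omega
    · intro y hy; simp only [Finset.mem_Ioo] at hy ⊢; omega
    · intro y hy; ring
    · intro y hy; ring
    · intro y hy
      have hd : r ∣ y - (s - x) ↔ r ∣ s - r - y - x := by
        rw [show s - r - y - x = -(y - (s - x)) - r by ring, dvd_sub_self_right, dvd_neg]
      simp only [hd]
      by_cases h : r ∣ s - r - y - x
      · simp only [h, if_true]
        by_cases h2 : s - x ≤ y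
        · rw [if_pos h2, if_neg (by omega)]; simp
        · rw [if_neg h2, if_pos]
          by_contra h3
          have : r ≤ -(s - r - y - x) := Int.le_of_dvd (by omega) (dvd_neg.mpr h)
          omega
      · simp [h]

def hp (s r : ℤ) (a b : ℕ) : ℕ := if s * a ≤ r * (b + 1) ∧ r * b < s * (a + 1) then 1 else 0

def hm (s r : ℤ) (a b : ℕ) : ℕ := if s * a < r * (b + 1) ∧ r * b ≤ s * (a + 1) then 1 else 0

lemma hp_eq (s r : ℤ) (hr : 0 < r) (hs : 0 < s) : hp s r = fun a b =>
    fz s r (fun d => if -r < d ∧ d < s then 1 else 0) a b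
      + fz s r (fun d => if d = s then 1 else 0) a b := by
  funext a b
  unfold hp fz
  simp only
  rw [mul_add, mul_add, mul_one, mul_one]
  generalize s * (a : ℤ) = x
  generalize r * (b : ℤ) = y
  split_ifs <;> omega

lemma hm_eq (s r : ℤ) (hr : 0 < r) (hs : 0 < s) : hm s r = fun a b =>
    fz s r (fun d => if -r < d ∧ d < s then 1 else 0) a b
      + fz s r (fun d => if d = -r then 1 else 0) a b := by
  funext a b
  unfold hm fz
  simp only
  rw [mul_add, mul_add, mul_one, mul_one]
  generalize s * (a : ℤ) = x
  generalize r * (b : ℤ) = y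
  split_ifs <;> omega

theorem core (s r : ℤ) (hr : 0 < r) (hs : 0 < s) (n N k : ℕ) :
    ((lists n).filter fun l => endp s r l 0 = 0 ∧ stat (fun _ _ => 1) l = N ∧
      stat (hm s r) l = k).card
    = ((lists n).filter fun l => endp s r l 0 = 0 ∧ stat (fun _ _ => 1) l = N ∧
      stat (hp s r) l = k).card := by
  classical
  let T : Finset E := (lists n).image fun l => edges s r l 0
  rw [Finset.card_eq_sum_card_fiberwise (f := fun l => edges s r l 0) (t := T)
      (fun l hl => Finset.mem_image_of_mem _ (Finset.mem_filter.mp hl).1),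
    Finset.card_eq_sum_card_fiberwise (f := fun l => edges s r l 0) (t := T)
      (fun l hl => Finset.mem_image_of_mem _ (Finset.mem_filter.mp hl).1)]
  apply Finset.sum_congr rfl
  intro m _
  rw [Finset.filter_filter, Finset.filter_filter, hp_eq s r hr hs, hm_eq s r hr hs]
  simp only [stat_add]
  by_cases hne : ∃ l ∈ lists n, edges s r l 0 = m ∧ endp s r l 0 = 0
  · obtain ⟨l0, hl0, rfl, h0⟩ := hne
    have key := AB s r hr n (edges s r l0 0)
    by_cases hN : stat (fun _ _ => 1) l0 = N ∧
        stat (fz s r fun d => if -r < d ∧ d < s then 1 else 0) l0 ≤ k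
    · have := key (k - stat (fz s r fun d => if -r < d ∧ d < s then 1 else 0) l0)
      convert this using 2
      · apply Finset.filter_congr
        intro l hl
        constructor
        · rintro ⟨⟨h1, h2, h3⟩, h4⟩
          have := stat_mid_congr s r hr l l0 0 h4 (by rw [h1, h0])
          exact ⟨h4, h1, by omega⟩
        · rintro ⟨h4, h1, h3⟩
          have := stat_mid_congr s r hr l l0 0 h4 (by rw [h1, h0])
          have := stat_one_congr s r hr l l0 0 h4 (by rw [h1, h0])
          exact ⟨⟨h1, by omega, by omega⟩, h4⟩
      · apply Finset.filter_congr
        intro l hl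
        constructor
        · rintro ⟨⟨h1, h2, h3⟩, h4⟩
          have := stat_mid_congr s r hr l l0 0 h4 (by rw [h1, h0])
          exact ⟨h4, h1, by omega⟩
        · rintro ⟨h4, h1, h3⟩
          have := stat_mid_congr s r hr l l0 0 h4 (by rw [h1, h0])
          have := stat_one_congr s r hr l l0 0 h4 (by rw [h1, h0])
          exact ⟨⟨h1, by omega, by omega⟩, h4⟩
    · rw [Finset.filter_false_of_mem, Finset.filter_false_of_mem]
      · rintro l hl ⟨⟨h1, h2, h3⟩, h4⟩
        have := stat_mid_congr s r hr l l0 0 h4 (by rw [h1, h0])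
        have := stat_one_congr s r hr l l0 0 h4 (by rw [h1, h0])
        exact hN ⟨by omega, by omega⟩
      · rintro l hl ⟨⟨h1, h2, h3⟩, h4⟩
        have := stat_mid_congr s r hr l l0 0 h4 (by rw [h1, h0])
        have := stat_one_congr s r hr l l0 0 h4 (by rw [h1, h0])
        exact hN ⟨by omega, by omega⟩
  · rw [Finset.filter_false_of_mem, Finset.filter_false_of_mem]
    · rintro l hl ⟨h, h4⟩; exact hne ⟨l, hl, h4, h.1⟩
    · rintro l hl ⟨h, h4⟩; exact hne ⟨l, hl, h4, h.1⟩

end LW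

namespace LW

open Polynomial

def cl : List Bool → Finset (ℕ × ℕ)
  | [] => ∅
  | true :: l => (Finset.range (l.count false)).image (fun v => (0, v)) ∪
      (cl l).image (fun c => (c.1 + 1, c.2))
  | false :: l => cl l

def col : List Bool → ℕ → ℕ
  | [], _ => 0
  | true :: l, 0 => l.count false
  | true :: l, u + 1 => col l u
  | false :: l, u => col l u

lemma mem_cl (l : List Bool) (u v : ℕ) : (u, v) ∈ cl l ↔ v < col l u := by
  induction l generalizing u with
  | nil => simp [cl, col]
  | cons x l ih =>
    cases x
    · simp [cl, col, ih]
    · cases u <;> simp [cl, col, ih]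

lemma col_le (l : List Bool) (u : ℕ) : col l u ≤ l.count false := by
  induction l generalizing u with
  | nil => simp [col]
  | cons x l ih =>
    cases x
    · have := ih u; simp [col]; omega
    · cases u <;> simp [col, ih]

lemma col_anti_succ (l : List Bool) (u : ℕ) : col l (u + 1) ≤ col l u := by
  induction l generalizing u with
  | nil => simp [col]
  | cons x l ih =>
    cases x
    · simp [col, ih]
    · cases u <;> simp [col, ih, col_le]

lemma col_inj (l l' : List Bool) (h1 : l.count true = l'.count true)
    (h2 : l.count false = l'.count false) (h : ∀ u, col l u = col l' u) : l = l' := by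
  induction l generalizing l' with
  | nil =>
    rcases l' with _ | ⟨_ | _, l'⟩
    · rfl
    · simp at h2
    · simp at h1
  | cons x l ih =>
    rcases l' with _ | ⟨y, l'⟩
    · cases x
      · simp at h2
      · simp at h1
    · cases x <;> cases y
      · rw [ih l' (by simpa using h1) (by simpa using h2) h]
      · have := h 0
        have h3 := col_le l 0
        simp [col] at this h2; omega
      · have := h 0
        have h3 := col_le l' 0
        simp [col] at this h2; omega
      · rw [ih l' (by simpa using h1) (by simpa using h2) fun u => h (u + 1)]

lemma col_surj (n M N : ℕ) (hn : M + N = n) (h : ℕ → ℕ) (ha : ∀ u, h (u + 1) ≤ h u) (h0 : h 0 ≤ N)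
    (hM : ∀ u, M ≤ u → h u = 0) :
    ∃ l : List Bool, l.count true = M ∧ l.count false = N ∧ ∀ u, col l u = h u := by
  induction n generalizing M N h with
  | zero => exact ⟨[], by simp; omega, by simp; omega, fun u => by rw [hM u (by omega)]; rfl⟩
  | succ n ih =>
    by_cases hc : 0 < M ∧ h 0 = N
    · obtain ⟨l, l1, l2, l3⟩ := ih (M - 1) N (by omega) (fun u => h (u + 1)) (fun u => ha _)
        (le_trans (ha 0) h0) (fun u hu => hM _ (by omega))
      refine ⟨true :: l, by simp [l1]; omega, by simp [l2], ?_⟩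
      intro u
      cases u with
      | zero => simp [col, l2, hc.2]
      | succ u => simp [col, l3]
    · have hN : 0 < N ∧ h 0 < N := by
        by_cases hM0 : M = 0
        · have := hM 0 (by omega); omega
        · omega
      obtain ⟨l, l1, l2, l3⟩ := ih M (N - 1) (by omega) h ha (by omega) hM
      refine ⟨false :: l, by simp [l1], by simp [l2]; omega, ?_⟩
      intro u
      simp [col, l3]

def arm (s : Finset (ℕ × ℕ)) (c : ℕ × ℕ) : ℕ := (s.filter fun d => d.2 = c.2 ∧ c.1 < d.1).card

def leg (s : Finset (ℕ × ℕ)) (c : ℕ × ℕ) : ℕ := (s.filter fun d => d.1 = c.1 ∧ c.2 < d.2).card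

lemma sum_cl (l : List Bool) (φ : ℕ × ℕ → ℕ) :
    ∑ c ∈ cl (true :: l), φ c
      = ∑ v ∈ Finset.range (l.count false), φ (0, v) + ∑ c ∈ cl l, φ (c.1 + 1, c.2) := by
  rw [cl, Finset.sum_union, Finset.sum_image, Finset.sum_image]
  · rintro ⟨a, b⟩ _ ⟨c, d⟩ _ h; simpa using h
  · intro a _ b _ h; simpa using h
  · rw [Finset.disjoint_left]; intro a h1 h2
    simp only [Finset.mem_image] at h1 h2
    obtain ⟨x, _, rfl⟩ := h1
    obtain ⟨y, _, hy⟩ := h2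
    simp at hy

def row : List Bool → ℕ → ℕ
  | [], _ => 0
  | true :: l, v => (if v < l.count false then 1 else 0) + row l v
  | false :: l, v => row l v

lemma row_eq (l : List Bool) (v : ℕ) : ((cl l).filter fun d => d.2 = v).card = row l v := by
  induction l with
  | nil => simp [cl, row]
  | cons x l ih =>
    cases x
    · simp [cl, row, ih]
    · rw [Finset.card_filter, sum_cl, row, ← ih, Finset.card_filter]
      congr 1
      rw [Finset.sum_ite_eq']
      simp

lemma row_zero (l : List Bool) (v : ℕ) (h : l.count false ≤ v) : row l v = 0 := by
  induction l with
  | nil => rfl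
  | cons x l ih =>
    cases x
    · simp at h; simp [row]; exact ih (by omega)
    · simp at h; simp [row, ih h]; omega

lemma cnt_row (f : ℕ → ℕ → ℕ) (a b : ℕ) (l : List Bool) :
    cnt f a b l = ∑ v ∈ Finset.range (l.count false), f (a + row l v) (b + (l.count false - 1 - v)) := by
  induction l generalizing a b with
  | nil => simp [cnt]
  | cons x l ih =>
    cases x
    · rw [cnt, ih]
      simp only [List.count_cons_self]
      rw [Finset.sum_range_succ, add_comm]
      congr 1
      · apply Finset.sum_congr rfl
        intro v hv
        rw [Finset.mem_range] at hv
        rw [row]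
        congr 1
        omega
      · rw [row, row_zero l _ le_rfl]; simp
    · rw [cnt, ih]
      simp only [List.count_cons_of_ne (show true ≠ false by simp)]
      apply Finset.sum_congr rfl
      intro v hv
      rw [Finset.mem_range] at hv
      rw [row, if_pos hv]
      congr 1
      omega

lemma arm_succ (l : List Bool) (u v : ℕ) : arm (cl (true :: l)) (u + 1, v) = arm (cl l) (u, v) := by
  unfold arm
  rw [Finset.card_filter, sum_cl, Finset.card_filter]
  simp

lemma leg_succ (l : List Bool) (u v : ℕ) : leg (cl (true :: l)) (u + 1, v) = leg (cl l) (u, v) := by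
  unfold leg
  rw [Finset.card_filter, sum_cl, Finset.card_filter]
  simp

lemma arm_zero (l : List Bool) (v : ℕ) : arm (cl (true :: l)) (0, v) = row l v := by
  unfold arm
  rw [Finset.card_filter, sum_cl, ← row_eq, Finset.card_filter]
  simp

lemma leg_zero (l : List Bool) (v : ℕ) :
    leg (cl (true :: l)) (0, v) = l.count false - 1 - v := by
  unfold leg
  rw [Finset.card_filter, sum_cl]
  simp only [true_and, Nat.succ_ne_zero, false_and, if_false, Finset.sum_const_zero, add_zero]
  rw [← Finset.card_filter]
  have : (Finset.range (l.count false)).filter (fun w => v < w)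
      = Finset.Ioo v (l.count false) := by
    ext w; simp; omega
  rw [this, Nat.card_Ioo]
  omega

lemma stat_eq (f : ℕ → ℕ → ℕ) (l : List Bool) :
    stat f l = ∑ c ∈ cl l, f (arm (cl l) c) (leg (cl l) c) := by
  induction l with
  | nil => simp [stat, cl]
  | cons x l ih =>
    cases x
    · rw [stat, ih]; rfl
    · rw [stat, sum_cl, ih, cnt_row]
      simp only [arm_succ, leg_succ, arm_zero, leg_zero, zero_add]

lemma col_anti (l : List Bool) : Antitone (col l) := antitone_nat_of_succ_le (col_anti_succ l)

def yd (l : List Bool) : YoungDiagram where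
  cells := cl l
  isLowerSet := by
    rintro ⟨a, b⟩ ⟨c, d⟩ h hab
    simp only [Finset.mem_coe, mem_cl] at hab ⊢
    obtain ⟨h1, h2⟩ := h
    simp only at h1 h2
    have := col_anti l h1
    omega

/-- number of diagrams with given size and statistic -/
noncomputable def Q (n k : ℕ) (f : ℕ → ℕ → ℕ) : ℕ :=
  Nat.card {Γ : YoungDiagram // Γ.card = n ∧
    ∑ c ∈ Γ.cells, f (arm Γ.cells c) (leg Γ.cells c) = k}

lemma rowLen_zero_le (Γ : YoungDiagram) : Γ.rowLen 0 ≤ Γ.card := by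
  rw [YoungDiagram.rowLen_eq_card]
  exact Finset.card_le_card (Finset.filter_subset _ _)

lemma rowLen_big (Γ : YoungDiagram) (u : ℕ) (hu : Γ.card ≤ u) : Γ.rowLen u = 0 := by
  by_contra h
  have h1 : (u, 0) ∈ Γ := by rw [YoungDiagram.mem_iff_lt_rowLen]; omega
  have h2 : u < Γ.colLen 0 := by rwa [← YoungDiagram.mem_iff_lt_colLen]
  have h3 : Γ.colLen 0 ≤ Γ.card := by
    rw [YoungDiagram.colLen_eq_card]
    exact Finset.card_le_card (Finset.filter_subset _ _)
  omega

theorem Q_eq (n k M N : ℕ) (hM : n ≤ M) (hN : n ≤ N) (f : ℕ → ℕ → ℕ) :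
    Q n k f = ((lists (M + N)).filter fun l => l.count true = M ∧ stat (fun _ _ => 1) l = n ∧
      stat f l = k).card := by
  unfold Q
  rw [← Fintype.card_coe, ← Nat.card_eq_fintype_card]
  symm
  have hlen : ∀ l : List Bool, l.count true + l.count false = l.length := by
    intro l
    induction l with
    | nil => rfl
    | cons x l ih => cases x <;> simp <;> omega
  refine Nat.card_congr (Equiv.ofBijective (fun l => ⟨yd l.1, ?_, ?_⟩) ⟨?_, ?_⟩)
  · have := l.2
    simp only [Finset.mem_filter] at this
    refine Eq.trans ?_ this.2.2.1
    rw [stat_eq]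
    simp [YoungDiagram.card, yd]
  · have := l.2
    simp only [Finset.mem_filter] at this
    refine Eq.trans ?_ this.2.2.2
    rw [stat_eq]
    rfl
  · rintro ⟨l, hl⟩ ⟨l', hl'⟩ h
    simp only [Finset.mem_filter, mem_lists] at hl hl'
    simp only [Subtype.mk.injEq] at h ⊢
    have h1 := hlen l
    have h2 := hlen l'
    refine col_inj l l' (by omega) (by omega) fun u => ?_
    have hc : cl l = cl l' := congrArg YoungDiagram.cells h
    have h3 := fun v => mem_cl l u v
    simp only [hc, mem_cl] at h3
    have h4 := h3 (col l u)
    have h5 := h3 (col l' u)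
    omega
  · rintro ⟨Γ, h1, h2⟩
    obtain ⟨l, l1, l2, l3⟩ := col_surj (M + N) M N rfl Γ.rowLen
      (fun u => Γ.rowLen_anti _ _ (Nat.le_succ u)) (by have := rowLen_zero_le Γ; omega)
      (fun u hu => rowLen_big Γ u (by omega))
    have hc : cl l = Γ.cells := by
      ext ⟨u, v⟩
      rw [mem_cl, l3, YoungDiagram.mem_cells, YoungDiagram.mem_iff_lt_rowLen]
    have hy : yd l = Γ := by ext1; exact hc
    refine ⟨⟨l, ?_⟩, ?_⟩
    · simp only [Finset.mem_filter, mem_lists]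
      refine ⟨by rw [← hlen]; omega, l1, ?_, ?_⟩
      · rw [stat_eq, hc, ← h1]; simp [YoungDiagram.card]
      · rw [stat_eq, hc, h2]
    · exact Subtype.ext hy

theorem cross (s r : ℕ) (hs : 0 < s) (hr : 0 < r) (n k : ℕ) :
    Q n k (hm s r) = Q n k (hp s r) := by
  have hM : n ≤ r * n := Nat.le_mul_of_pos_left n hr
  have hN : n ≤ s * n := Nat.le_mul_of_pos_left n hs
  rw [Q_eq n k (r * n) (s * n) hM hN, Q_eq n k (r * n) (s * n) hM hN]
  have key := core s r (by exact_mod_cast hr) (by exact_mod_cast hs) (r * n + s * n) n k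
  have hlen : ∀ l : List Bool, l.count true + l.count false = l.length := by
    intro l
    induction l with
    | nil => rfl
    | cons x l ih => cases x <;> simp <;> omega
  have : ∀ l ∈ lists (r * n + s * n), endp s r l 0 = 0 ↔ l.count true = r * n := by
    intro l hl
    rw [mem_lists] at hl
    have h1 := hlen l
    rw [hl] at h1
    rw [endp_count]
    zify at h1 ⊢
    have hpos : (0 : ℤ) < s + r := by exact_mod_cast (by omega : 0 < s + r)
    constructor
    · intro h
      apply mul_left_cancel₀ hpos.ne'
      linear_combination h + (r : ℤ) * h1
    · intro h
      have h2 : (l.count false : ℤ) = s * n := by linarith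
      rw [h, h2]; ring
  convert key using 2
  · apply Finset.filter_congr
    intro l hl
    rw [this l hl]
  · apply Finset.filter_congr
    intro l hl
    rw [this l hl]

def hpq (x : ℚ) (a b : ℕ) : ℕ := if (a : ℚ) ≤ x * (b + 1) ∧ x * b < a + 1 then 1 else 0

def hmq (x : ℚ) (a b : ℕ) : ℕ := if (a : ℚ) < x * (b + 1) ∧ x * b ≤ a + 1 then 1 else 0

lemma q_le (x : ℚ) (u v : ℤ) : (u : ℚ) ≤ x * v ↔ x.den * u ≤ x.num * v := by
  have hd : (0 : ℚ) < x.den := by exact_mod_cast x.den_pos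
  have hx : x * x.den = x.num := Rat.mul_den_eq_num x
  rw [← mul_le_mul_iff_right₀ hd, show (x.den : ℚ) * (x * v) = x.num * v by rw [← hx]; ring]
  exact_mod_cast Iff.rfl

lemma q_le' (x : ℚ) (u v : ℤ) : x * v ≤ (u : ℚ) ↔ x.num * v ≤ x.den * u := by
  have hd : (0 : ℚ) < x.den := by exact_mod_cast x.den_pos
  have hx : x * x.den = x.num := Rat.mul_den_eq_num x
  rw [← mul_le_mul_iff_right₀ hd, show (x.den : ℚ) * (x * v) = x.num * v by rw [← hx]; ring]
  exact_mod_cast Iff.rfl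

lemma hpq_eq (x : ℚ) (hx : 0 < x) : hpq x = hp x.den x.num.toNat := by
  have hn : ((x.num.toNat : ℕ) : ℤ) = x.num := Int.toNat_of_nonneg (Rat.num_pos.mpr hx).le
  funext a b
  unfold hpq hp
  rw [hn]
  have h1 := q_le x a (b + 1)
  have h2 := q_le x (a + 1) b
  push_cast at h1 h2
  apply if_congr _ rfl rfl
  rw [h1, ← not_le, h2, not_le]

lemma hmq_eq (x : ℚ) (hx : 0 < x) : hmq x = hm x.den x.num.toNat := by
  have hn : ((x.num.toNat : ℕ) : ℤ) = x.num := Int.toNat_of_nonneg (Rat.num_pos.mpr hx).le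
  funext a b
  unfold hmq hm
  rw [hn]
  have h1 := q_le' x a (b + 1)
  have h2 := q_le' x (a + 1) b
  push_cast at h1 h2
  apply if_congr _ rfl rfl
  rw [h2, ← not_le, h1, not_le]

end LW
namespace LW

lemma cross_q (x : ℚ) (hx : 0 < x) (n k : ℕ) : Q n k (hmq x) = Q n k (hpq x) := by
  rw [hmq_eq x hx, hpq_eq x hx]
  refine cross x.den x.num.toNat x.den_pos ?_ n k
  have := Rat.num_pos.mpr hx
  omega

lemma Q_congr (n k : ℕ) (f g : ℕ → ℕ → ℕ) (h : ∀ a b, a ≤ n → b ≤ n → f a b = g a b) :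
    Q n k f = Q n k g := by
  unfold Q
  have : ∀ Γ : YoungDiagram, (Γ.card = n ∧
      ∑ c ∈ Γ.cells, f (arm Γ.cells c) (leg Γ.cells c) = k) ↔ (Γ.card = n ∧
      ∑ c ∈ Γ.cells, g (arm Γ.cells c) (leg Γ.cells c) = k) := by
    intro Γ
    apply and_congr_right
    intro hΓ
    rw [Finset.sum_congr rfl]
    intro c _
    apply h
    · rw [← hΓ]; exact Finset.card_le_card (Finset.filter_subset _ _)
    · rw [← hΓ]; exact Finset.card_le_card (Finset.filter_subset _ _)
  simp only [this]

def crit (n : ℕ) : Finset ℚ :=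
  (Finset.Icc 1 (n + 1) ×ˢ Finset.Icc 1 (n + 1)).image fun p => (p.1 : ℚ) / p.2

lemma mem_crit (n i j : ℕ) (hi : 1 ≤ i) (hi' : i ≤ n + 1) (hj : 1 ≤ j) (hj' : j ≤ n + 1) :
    (i : ℚ) / j ∈ crit n := by
  unfold crit
  rw [Finset.mem_image]
  exact ⟨(i, j), by simp; omega, rfl⟩

theorem chain (n k t : ℕ) (y : ℚ) (hy : 0 < y) (ht : ((crit n).filter fun c => y < c).card = t) :
    Q n k (hpq y) = Q n k (fun _ b => if b = 0 then 1 else 0) := by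
  induction t using Nat.strong_induction_on generalizing y with
  | _ t ih =>
  by_cases hne : ((crit n).filter fun c => y < c).Nonempty
  · set z := ((crit n).filter fun c => y < c).min' hne with hz
    have hzm : z ∈ (crit n).filter fun c => y < c := Finset.min'_mem _ _
    have hyz : y < z := (Finset.mem_filter.mp hzm).2
    have hz0 : 0 < z := hy.trans hyz
    have hmin : ∀ c ∈ crit n, y < c → z ≤ c := fun c hc hyc =>
      Finset.min'_le _ _ (Finset.mem_filter.mpr ⟨hc, hyc⟩)
    have h1 : Q n k (hpq y) = Q n k (hmq z) := by
      apply Q_congr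
      intro a b ha hb
      unfold hpq hmq
      apply if_congr _ rfl rfl
      apply and_congr
      · have hb1 : (0 : ℚ) < (b : ℚ) + 1 := by positivity
        rw [← div_le_iff₀ hb1, ← div_lt_iff₀ hb1]
        constructor
        · intro h; exact lt_of_le_of_lt h hyz
        · intro h
          by_contra hc
          push Not at hc
          by_cases ha0 : a = 0
          · subst ha0; simp at hc; linarith
          · have := hmin ((a : ℚ) / ((b + 1 : ℕ) : ℚ))
              (mem_crit n a (b + 1) (by omega) (by omega) (by omega) (by omega))
              (by push_cast; exact hc)
            push_cast at this
            linarith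
      · by_cases hb0 : b = 0
        · subst hb0
          have : (0 : ℚ) < a + 1 := by positivity
          simp [this, this.le]
        · have hb1 : (0 : ℚ) < (b : ℚ) := by exact_mod_cast Nat.pos_of_ne_zero hb0
          rw [← lt_div_iff₀ hb1, ← le_div_iff₀ hb1]
          constructor
          · intro h
            have := hmin (((a + 1 : ℕ) : ℚ) / (b : ℚ))
              (mem_crit n (a + 1) b (by omega) (by omega) (by omega) (by omega))
              (by push_cast; exact h)
            push_cast at this
            exact this
          · intro h; exact lt_of_lt_of_le hyz h
    rw [h1, cross_q z hz0]
    refine ih _ ?_ z hz0 rfl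
    rw [← ht]
    apply Finset.card_lt_card
    rw [Finset.ssubset_iff_of_subset]
    · exact ⟨z, hzm, by simp⟩
    · intro c hc
      rw [Finset.mem_filter] at hc ⊢
      exact ⟨hc.1, hyz.trans hc.2⟩
  · have hbig : (n : ℚ) + 1 ≤ y := by
      by_contra hc
      push Not at hc
      refine hne ⟨((n + 1 : ℕ) : ℚ) / ((1 : ℕ) : ℚ), ?_⟩
      rw [Finset.mem_filter]
      refine ⟨mem_crit n _ _ (by omega) (by omega) (by omega) (by omega), ?_⟩
      push_cast
      simpa using hc
    apply Q_congr
    intro a b ha hb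
    unfold hpq
    have ha' : (a : ℚ) ≤ n := by exact_mod_cast ha
    apply if_congr _ rfl rfl
    constructor
    · rintro ⟨_, h⟩
      by_contra hb0
      have hb1 : (1 : ℚ) ≤ b := by exact_mod_cast Nat.pos_of_ne_zero hb0
      nlinarith
    · rintro rfl
      constructor
      · simp; linarith
      · simp; positivity

lemma leg_count (Γ : YoungDiagram) :
    ∑ c ∈ Γ.cells, (if leg Γ.cells c = 0 then 1 else 0) = (Γ.cells.filter fun c => c.2 = 0).card := by
  rw [← Finset.card_filter]
  have hlow : ∀ {a b c : ℕ}, (a, b) ∈ Γ → c ≤ b → (a, c) ∈ Γ := by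
    intro a b c h hc
    exact Γ.isLowerSet (show (a, c) ≤ (a, b) from ⟨le_rfl, hc⟩) h
  have hleg : ∀ u v w, leg Γ.cells (u, v) = 0 → (u, w) ∈ Γ → w ≤ v := by
    intro u v w h hw
    by_contra hc
    push Not at hc
    unfold leg at h
    rw [Finset.card_eq_zero] at h
    have : (u, w) ∈ Γ.cells.filter fun d => d.1 = (u, v).1 ∧ (u, v).2 < d.2 := by
      rw [Finset.mem_filter]; exact ⟨by simpa using hw, rfl, hc⟩
    rw [h] at this
    simp at this
  refine Finset.card_bij (fun c _ => (c.1, 0)) ?_ ?_ ?_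
  · rintro ⟨u, v⟩ h
    rw [Finset.mem_filter] at h ⊢
    exact ⟨hlow h.1 (Nat.zero_le v), rfl⟩
  · rintro ⟨u, v⟩ h ⟨u', v'⟩ h' he
    rw [Finset.mem_filter] at h h'
    simp only [Prod.mk.injEq, and_true] at he
    subst he
    have h1 := hleg u v v' h.2 h'.1
    have h2 := hleg u v' v h'.2 h.1
    rw [le_antisymm h2 h1]
  · rintro ⟨u, v⟩ h
    rw [Finset.mem_filter] at h
    simp only at h
    obtain ⟨h1, rfl⟩ := h
    have h2 : 0 < Γ.rowLen u := by
      rw [← YoungDiagram.mem_iff_lt_rowLen]; simpa using h1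
    refine ⟨(u, Γ.rowLen u - 1), ?_, rfl⟩
    rw [Finset.mem_filter]
    constructor
    · rw [YoungDiagram.mem_cells, YoungDiagram.mem_iff_lt_rowLen]; omega
    · unfold leg
      rw [Finset.card_eq_zero, Finset.filter_eq_empty_iff]
      rintro ⟨a, b⟩ hab ⟨h3, h4⟩
      simp only at h3 h4
      subst h3
      rw [YoungDiagram.mem_cells, YoungDiagram.mem_iff_lt_rowLen] at hab
      omega

end LW

/-- The number of Young diagrams of `n` with `k` columns equals the number of Young
diagrams of `n` with exactly `k` boxes of hook difference `0` or `1`. -/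
theorem statement8 (n k : ℕ) :
    Nat.card {Γ : YoungDiagram // Γ.card = n ∧ ell Γ = k}
      = Nat.card {Γ : YoungDiagram // Γ.card = n ∧
          (Γ.cells.filter fun c =>
            hookDiff Γ.cells c = 0 ∨ hookDiff Γ.cells c = 1).card = k} := by
  have key := LW.chain n k _ 1 one_pos rfl
  unfold LW.Q at key
  simp only [LW.leg_count] at key
  refine key.symm.trans ?_
  have : ∀ Γ : YoungDiagram, ∑ c ∈ Γ.cells, LW.hpq 1 (LW.arm Γ.cells c) (LW.leg Γ.cells c)
      = (Γ.cells.filter fun c =>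
            hookDiff Γ.cells c = 0 ∨ hookDiff Γ.cells c = 1).card := by
    intro Γ
    rw [Finset.card_filter]
    apply Finset.sum_congr rfl
    intro c _
    unfold LW.hpq
    apply if_congr _ rfl rfl
    change _ ↔ ((LW.arm Γ.cells c : ℤ) - (LW.leg Γ.cells c : ℤ) = 0 ∨
      (LW.arm Γ.cells c : ℤ) - (LW.leg Γ.cells c : ℤ) = 1)
    generalize LW.arm Γ.cells c = a
    generalize LW.leg Γ.cells c = b
    rw [one_mul, one_mul]
    have h1 : (a : ℚ) ≤ b + 1 ↔ a ≤ b + 1 := by exact_mod_cast Iff.rfl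
    have h2 : (b : ℚ) < a + 1 ↔ b < a + 1 := by exact_mod_cast Iff.rfl
    rw [h1, h2]
    omega
  simp only [this]
end
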